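/- arXiv:1407.1179 — 2 statements merged into one kernel-verified Lean document; each statement's English description precedes it below -/
import Mathlib

section
/- Let (X,T) be a minimal t.d.s., let d ≥ 1 be an integer and let x, y ∈ X. Then (x,y) ∈ RP^[d] if and only if for every open neighborhood U of y, N(x,U) is a Poincaré recurrence set of order d. -/
open scoped Classical
open MeasureTheory Filter Topology

noncomputable section

/-- Integer iterate of a bijection `T` of a set: `zIter T n = T^n`. -/
def zIter {X : Type*} (T : Equiv.Perm X) (n : ℤ) : X → X := ⇑(T ^ n)

/-- Integer iterate of a homeomorphism. -/
def hIter {X : Type*} [TopologicalSpace X] (T : X ≃ₜ X) (n : ℤ) : X → X :=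
  zIter T.toEquiv n

/-- The integer nearest to `a`, with ties broken towards the smaller integer.
This is the `⌈·⌉` of the paper. -/
def nearInt (a : ℝ) : ℤ := if a - (⌊a⌋ : ℝ) ≤ 1/2 then ⌊a⌋ else ⌈a⌉

/-- The distance from `a` to the nearest integer, i.e. `‖a‖` in the paper. -/
def distInt (a : ℝ) : ℝ := |a - (nearInt a : ℝ)|

/-- Generalized polynomials of degree at most `d` (for `d ≥ 1`):
`GP 1` is the smallest collection of functions `ℤ → ℝ` containing `n ↦ a n`
and closed under taking the nearest integer, scalar multiplication and finite sums;
`GP d` moreover contains every `GP e` for `e < d` and all functions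
`n ↦ a₀ n^{p₀} ⌈f₁(n)⌉ ⋯ ⌈f k (n)⌉` with `f l ∈ GP (p l)` and `p₀ + ∑ p l = d`. -/
inductive GP : ℕ → (ℤ → ℝ) → Prop
  | lin (a : ℝ) : GP 1 (fun n => a * n)
  | mono {d : ℕ} (hd : 1 ≤ d) (a₀ : ℝ) (p₀ : ℕ) {k : ℕ} (p : Fin k → ℕ)
      (f : Fin k → ℤ → ℝ) (hf : ∀ l, GP (p l) (f l)) (hsum : p₀ + ∑ l, p l = d) :
      GP d (fun n => a₀ * (n : ℝ) ^ p₀ * ∏ l, (nearInt (f l n) : ℝ))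
  | incl {d e : ℕ} (hed : e < d) {f : ℤ → ℝ} (hf : GP e f) : GP d f
  | ceil {d : ℕ} {f : ℤ → ℝ} (hf : GP d f) : GP d (fun n => (nearInt (f n) : ℝ))
  | smul {d : ℕ} (c : ℝ) {f : ℤ → ℝ} (hf : GP d f) : GP d (fun n => c * f n)
  | add {d : ℕ} {f g : ℤ → ℝ} (hf : GP d f) (hg : GP d g) : GP d (fun n => f n + g n)

/-- The bracket expression `L(a₁, …, a_ℓ) = a₁⌈L(a₂, …, a_ℓ)⌉`, `L(a) = a`. -/
def Lfun : List ℝ → ℝ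
  | [] => 0
  | [a] => a
  | a :: b :: rest => a * (nearInt (Lfun (b :: rest)) : ℝ)

/-- Special generalized polynomials of degree at most `d`:
the functions `n ↦ L(n^{j₁} a₁, …, n^{j_ℓ} a_ℓ)` with `1 ≤ ℓ`, `j t ≥ 1`, `∑ j t ≤ d`. -/
def SGP (d : ℕ) (g : ℤ → ℝ) : Prop :=
  ∃ ℓ : ℕ, 1 ≤ ℓ ∧ ∃ (a : Fin ℓ → ℝ) (j : Fin ℓ → ℕ),
    (∀ t, 1 ≤ j t) ∧ (∑ t, j t) ≤ d ∧
    g = fun n : ℤ => Lfun (List.ofFn fun t => (n : ℝ) ^ (j t) * a t)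

/-- `FS({n i}) = {n_{i₁} + ⋯ + n_{i_k} : i₁ < ⋯ < i_k}`, the set of finite sums. -/
def FS {d : ℕ} (n : Fin d → ℤ) : Set ℤ :=
  { m | ∃ I : Finset (Fin d), I.Nonempty ∧ m = ∑ i ∈ I, n i }

/-- `SG d P`: sums `p_{i₁} + ⋯ + p_{i_k}` over strictly increasing finite index
sequences whose consecutive gaps are at most `d` (infinite sequence `P`). -/
def SG (d : ℕ) (P : ℕ → ℤ) : Set ℤ :=
  { n | ∃ k : ℕ, ∃ i : Fin (k + 1) → ℕ, StrictMono i ∧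
      (∀ t : Fin k, i t.succ - i t.castSucc ≤ d) ∧ n = ∑ t, P (i t) }

/-- `SGfin d P` : the same for a finite sequence `P` of length `m`. -/
def SGfin (d : ℕ) {m : ℕ} (P : Fin m → ℤ) : Set ℤ :=
  { n | ∃ k : ℕ, ∃ i : Fin (k + 1) → Fin m, StrictMono i ∧
      (∀ t : Fin k, (i t.succ : ℕ) - (i t.castSucc : ℕ) ≤ d) ∧ n = ∑ t, P (i t) }

/-- A set of integers is syndetic if it has bounded gaps. -/
def Syndetic (A : Set ℤ) : Prop :=
  ∃ N : ℕ, ∀ i : ℤ, ∃ j, i ≤ j ∧ j ≤ i + N ∧ j ∈ A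

/-- `F` has positive upper Banach density. -/
def PosUpperBanachDensity (F : Set ℤ) : Prop :=
  ∃ δ : ℝ, 0 < δ ∧ ∀ N : ℕ, ∃ (a : ℤ) (L : ℕ), N ≤ L ∧ 1 ≤ L ∧
    δ * L ≤ ((Finset.Icc a (a + L - 1)).filter (fun x => x ∈ F)).card

/-- A set `A ⊆ ℤ` contains finite IP-sets of arbitrarily long lengths. -/
def ContainsArbLongFIP (A : Set ℤ) : Prop :=
  ∀ k : ℕ, 1 ≤ k → ∃ p : Fin k → ℤ, FS p ⊆ A

/-- A topological dynamical system `(X, T)` is minimal: every orbit is dense. -/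
def MinimalTDS {X : Type*} [TopologicalSpace X] (T : X ≃ₜ X) : Prop :=
  ∀ x : X, Dense (Set.range fun n : ℤ => hIter T n x)

/-- `Nset T x U = N(x, U) = {n ∈ ℤ : Tⁿ x ∈ U}`. -/
def Nset {X : Type*} [TopologicalSpace X] (T : X ≃ₜ X) (x : X) (U : Set X) : Set ℤ :=
  { n : ℤ | hIter T n x ∈ U }

/-- The regionally proximal relation of order `d`. -/
def RPd {X : Type*} [MetricSpace X] (T : X ≃ₜ X) (d : ℕ) (x y : X) : Prop :=
  ∀ δ : ℝ, 0 < δ → ∃ (x' y' : X) (n : Fin d → ℤ),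
    dist x x' < δ ∧ dist y y' < δ ∧
    ∀ ε : Finset (Fin d), ε.Nonempty →
      dist (hIter T (∑ i ∈ ε, n i) x') (hIter T (∑ i ∈ ε, n i) y') < δ

/-- `S` is a set of `d`-topological recurrence. -/
def TopRecSet (d : ℕ) (S : Set ℤ) : Prop :=
  ∀ (X : Type) [MetricSpace X] [CompactSpace X] (T : X ≃ₜ X), MinimalTDS T →
    ∀ U : Set X, IsOpen U → U.Nonempty →
      ∃ n ∈ S, (⋂ j ∈ Finset.range (d + 1), hIter T ((j : ℤ) * n) ⁻¹' U).Nonempty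

/-- `S` is a set of `d`-recurrence (measurable recurrence). -/
def MeasRecSet (d : ℕ) (S : Set ℤ) : Prop :=
  ∀ (Y : Type) [MeasurableSpace Y] [StandardBorelSpace Y]
    (μ : Measure Y) [IsProbabilityMeasure μ] (T : Y ≃ᵐ Y),
    MeasurePreserving (⇑T) μ μ →
    ∀ A : Set Y, MeasurableSet A → 0 < μ A →
      ∃ n ∈ S, 0 < μ (⋂ j ∈ Finset.range (d + 1), zIter T.toEquiv ((j : ℤ) * n) ⁻¹' A)

/-- `P` is a Birkhoff recurrence set of order `d`. -/
def BirkhoffRecSet (d : ℕ) (P : Set ℤ) : Prop :=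
  ∀ (X : Type) [MetricSpace X] [CompactSpace X] (T : X ≃ₜ X), MinimalTDS T →
    ∀ U : Set X, IsOpen U → U.Nonempty →
      ∃ n : Fin d → ℤ, FS n ⊆ P ∧ (U ∩ ⋂ m ∈ FS n, hIter T m ⁻¹' U).Nonempty

/-- `F` is a Poincaré recurrence set of order `d`. -/
def PoincareRecSet (d : ℕ) (F : Set ℤ) : Prop :=
  ∀ (Y : Type) [MeasurableSpace Y] [StandardBorelSpace Y]
    (μ : Measure Y) [IsProbabilityMeasure μ] (T : Y ≃ᵐ Y),
    MeasurePreserving (⇑T) μ μ →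
    ∀ A : Set Y, MeasurableSet A → 0 < μ A →
      ∃ n : Fin d → ℤ, FS n ⊆ F ∧ 0 < μ (A ∩ ⋂ m ∈ FS n, zIter T.toEquiv m ⁻¹' A)

/-- The upper unitriangular matrix `M(a)` with entries `(M(a))_{i, i+k} = a i k`
(1-based indexing). -/
def Mmat (d : ℕ) (a : ℕ → ℕ → ℝ) : Matrix (Fin (d + 1)) (Fin (d + 1)) ℝ :=
  fun r c =>
    if (r : ℕ) = (c : ℕ) then 1
    else if (r : ℕ) < (c : ℕ) then a ((r : ℕ) + 1) ((c : ℕ) - (r : ℕ)) else 0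

/-- `P_ℓ(a; i, k) = ∑ a_i^{s₁} a_{i+s₁}^{s₂} ⋯`, sum over `(s₁,…,s_ℓ) ∈ {1,…,k}^ℓ`
with `s₁ + ⋯ + s_ℓ = k`. -/
def Ppoly (a : ℕ → ℕ → ℝ) (i k ℓ : ℕ) : ℝ :=
  ∑ s ∈ Finset.univ.filter (fun s : Fin ℓ → Fin k => (∑ t, ((s t : ℕ) + 1)) = k),
    ∏ t : Fin ℓ,
      a (i + ∑ u ∈ Finset.univ.filter (fun u : Fin ℓ => u < t), ((s u : ℕ) + 1))
        ((s t : ℕ) + 1)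

/-- The upper unitriangular matrix with superdiagonal `α₁, …, α_d` (1-based). -/
def Amat (d : ℕ) (α : ℕ → ℝ) : Matrix (Fin (d + 1)) (Fin (d + 1)) ℝ :=
  fun r c =>
    if (r : ℕ) = (c : ℕ) then 1
    else if (c : ℕ) = (r : ℕ) + 1 then α ((r : ℕ) + 1) else 0

end


set_option linter.all false
section AlgPart
variable {G : Type*} [Group G]

/-- closure under pulling back along disjoint blocks -/
def PullClosed (F : Subgroup (Finset ℕ → G)) : Prop :=
  ∀ φ ∈ F, ∀ C : ℕ → Finset ℕ, (∀ i j, i ≠ j → Disjoint (C i) (C j)) →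
    (fun S : Finset ℕ => φ (S.biUnion C)) ∈ F

theorem alg_step2 (F : Subgroup (Finset ℕ → G)) (hF : PullClosed F)
    (Θ : Finset ℕ → G) (hΘ : Θ ∈ F) (r : ℕ) (h0 : Θ ∅ = 1) (D : Finset ℕ) (hD : r ∉ D) :
    (fun S : Finset ℕ => Θ (insert r (S ∩ D)) * (Θ {r})⁻¹) ∈ F := by
  induction D using Finset.induction_on with
  | empty =>
    convert F.one_mem using 1
    funext S
    simp
  | insert i D' hi ih =>
    have hr : r ≠ i := fun h => hD (by simp [h])
    have hrD : r ∉ D' := fun h => hD (by simp [h])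
    have hχ := ih hrD
    have hμ := hF Θ hΘ (fun j => if j = i then {i, r} else if j ∈ D' then {j} else ∅) (by
      intro a b hab
      rw [Finset.disjoint_left]
      intro z
      by_cases h1 : a = i <;> by_cases h2 : b = i <;> by_cases h3 : a ∈ D' <;>
        by_cases h4 : b ∈ D' <;> simp_all <;> grind)
    have hν := hF Θ hΘ (fun j => if j = i then {r} else if j ∈ D' then {j} else ∅) (by
      intro a b hab
      rw [Finset.disjoint_left]
      intro z
      by_cases h1 : a = i <;> by_cases h2 : b = i <;> by_cases h3 : a ∈ D' <;>
        by_cases h4 : b ∈ D' <;> simp_all <;> grind)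
    have hρ := hF Θ hΘ (fun j => if j = i then {r} else ∅) (by
      intro a b hab
      rw [Finset.disjoint_left]
      intro z
      by_cases h1 : a = i <;> by_cases h2 : b = i <;> simp_all)
    have key := F.mul_mem (F.mul_mem (F.mul_mem (F.mul_mem hχ hρ) (F.inv_mem hν)) hμ)
      (F.inv_mem hρ)
    convert key using 1
    funext S
    simp only [Pi.mul_apply, Pi.inv_apply]
    by_cases hS : i ∈ S
    · have e1 : (S.biUnion fun j => if j = i then ({r} : Finset ℕ) else ∅) = {r} := by
        ext z; simp only [Finset.mem_biUnion]; grind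
      have e2 : (S.biUnion fun j => if j = i then ({r} : Finset ℕ) else
          if j ∈ D' then {j} else ∅) = insert r (S ∩ D') := by
        ext z; simp only [Finset.mem_biUnion]
        constructor
        · rintro ⟨a, ha, hz⟩; grind
        · intro hz
          by_cases hzr : z = r
          · exact ⟨i, hS, by simp [hzr]⟩
          · exact ⟨z, by grind, by grind⟩
      have e3 : (S.biUnion fun j => if j = i then ({i, r} : Finset ℕ) else
          if j ∈ D' then {j} else ∅) = insert r (S ∩ insert i D') := by
        ext z; simp only [Finset.mem_biUnion]
        constructor
        · rintro ⟨a, ha, hz⟩; grind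
        · intro hz
          by_cases hzr : z = r
          · exact ⟨i, hS, by simp [hzr]⟩
          · exact ⟨z, by grind, by grind⟩
      rw [e1, e2, e3]
      group
    · have e1 : (S.biUnion fun j => if j = i then ({r} : Finset ℕ) else ∅) = ∅ := by
        ext z; simp only [Finset.mem_biUnion]; grind
      have e2 : (S.biUnion fun j => if j = i then ({r} : Finset ℕ) else
          if j ∈ D' then {j} else ∅) = S ∩ D' := by
        ext z; simp only [Finset.mem_biUnion]
        constructor
        · rintro ⟨a, ha, hz⟩; grind
        · intro hz
          exact ⟨z, by grind, by grind⟩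
      have e3 : (S.biUnion fun j => if j = i then ({i, r} : Finset ℕ) else
          if j ∈ D' then {j} else ∅) = S ∩ D' := by
        ext z; simp only [Finset.mem_biUnion]
        constructor
        · rintro ⟨a, ha, hz⟩; grind
        · intro hz
          exact ⟨z, by grind, by grind⟩
      have e4 : S ∩ insert i D' = S ∩ D' := by grind
      rw [e1, e2, e3, e4, h0]
      group

theorem alg_step3 (F : Subgroup (Finset ℕ → G)) (hF : PullClosed F) (hF0 : ∀ φ ∈ F, φ ∅ = 1)
    (A : Subgroup G) (B : Set G) (hBA : ∀ b ∈ B, ∀ a ∈ A, b * a ∈ B)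
    (d : ℕ) (Θ : Finset ℕ → G) (hΘ : Θ ∈ F)
    (h1 : Θ {d + 1} ∈ A) (h2 : Θ {0, d + 1} ∈ B)
    (h3 : ∀ ε : Finset ℕ, ε ⊆ Finset.Icc 1 d → ε.Nonempty →
      (Θ (insert (d + 1) ε))⁻¹ * Θ (insert (d + 1) (insert 0 ε)) ∈ A) :
    ∃ Ψ ∈ F, ∀ S : Finset ℕ, S ⊆ Finset.range (d + 1) →
      (0 ∉ S → Ψ S = 1) ∧ (S = {0} → Ψ S ∈ B) ∧ (0 ∈ S → S ≠ {0} → Ψ S ∈ A) := by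
  have hχ := alg_step2 F hF Θ hΘ (d + 1) (hF0 _ hΘ) (Finset.range (d + 1)) (by simp)
  have hα := hF _ hχ (fun j => if j = 0 then ∅ else {j}) (by
    intro a b hab
    rw [Finset.disjoint_left]
    intro z
    by_cases ha : a = 0 <;> by_cases hb : b = 0 <;> simp_all
    )
  refine ⟨_, F.mul_mem (F.inv_mem hα) hχ, ?_⟩
  intro S hS
  have eS : S ∩ Finset.range (d + 1) = S := Finset.inter_eq_left.2 hS
  have eU : (S.biUnion fun j => if j = 0 then (∅ : Finset ℕ) else {j}) = S.erase 0 := by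
    ext z; simp only [Finset.mem_biUnion]
    constructor
    · rintro ⟨a, ha, hz⟩
      by_cases h : a = 0
      · simp [h] at hz
      · simp only [h, if_false, Finset.mem_singleton] at hz
        subst hz
        simp [h, ha]
    · intro hz
      simp only [Finset.mem_erase] at hz
      exact ⟨z, hz.2, by simp [hz.1]⟩
  have eE : S.erase 0 ∩ Finset.range (d + 1) = S.erase 0 :=
    Finset.inter_eq_left.2 ((Finset.erase_subset _ _).trans hS)
  simp only [Pi.mul_apply, Pi.inv_apply, eU, eS, eE]
  refine ⟨?_, ?_, ?_⟩
  · intro h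
    rw [Finset.erase_eq_of_notMem h]
    group
  · rintro rfl
    have : insert (d + 1) ({0} : Finset ℕ) = {0, d + 1} := Finset.pair_comm _ _
    simp only [Finset.erase_singleton, this]
    have := hBA _ h2 _ (A.inv_mem h1)
    convert this using 1
    simp
  · intro h hne
    have hh := h3 (S.erase 0) (by
      intro z hz
      have := hS (Finset.mem_of_mem_erase hz)
      simp at hz this ⊢
      omega) (by
      rw [Finset.nonempty_iff_ne_empty]
      intro h'
      rw [Finset.erase_eq_empty_iff] at h'
      rcases h' with h' | h'
      · simp [h'] at h
      · exact hne h')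
    rw [Finset.insert_erase h] at hh
    have := A.mul_mem (A.mul_mem h1 hh) (A.inv_mem h1)
    convert this using 1
    group

/-- gap condition -/
def GapOK (d : ℕ) (S : Finset ℕ) : Prop :=
  ∃ m ∈ S, ∀ k ∈ S, m ≤ k ∧ (k ≠ m → ∃ l ∈ S, l < k ∧ k ≤ l + d)

theorem alg_step4 (F : Subgroup (Finset ℕ → G)) (hF : PullClosed F) (hF0 : ∀ φ ∈ F, φ ∅ = 1)
    (A : Subgroup G) (B : Set G) (hBA : ∀ b ∈ B, ∀ a ∈ A, b * a ∈ B)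
    (d : ℕ) (Θ : Finset ℕ → G) (hΘ : Θ ∈ F)
    (h1 : Θ {d + 1} ∈ A) (h2 : Θ {0, d + 1} ∈ B)
    (h3 : ∀ ε : Finset ℕ, ε ⊆ Finset.Icc 1 d → ε.Nonempty →
      (Θ (insert (d + 1) ε))⁻¹ * Θ (insert (d + 1) (insert 0 ε)) ∈ A) (K : ℕ) :
    ∃ θ ∈ F, ∀ S : Finset ℕ, S ⊆ Finset.range K → GapOK d S → θ S ∈ B := by
  obtain ⟨Ψ, hΨ, hΨS⟩ := alg_step3 F hF hF0 A B hBA d Θ hΘ h1 h2 h3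
  suffices H : ∀ K : ℕ, ∃ θ ∈ F, ∀ S : Finset ℕ, ∀ m ∈ S, 
      (∀ k ∈ S, m ≤ k ∧ (k ≠ m → ∃ l ∈ S, l < k ∧ k ≤ l + d)) →
      (K ≤ m → θ S = 1) ∧ (m < K → θ S ∈ B) by
    obtain ⟨θ, hθ, h⟩ := H K
    refine ⟨θ, hθ, ?_⟩
    rintro S hS ⟨m, hm, hm'⟩
    exact (h S m hm hm').2 (by simpa using hS hm)
  intro K
  induction K with
  | zero => exact ⟨1, F.one_mem, fun S m hm h => ⟨fun _ => rfl, fun h => absurd h (by omega)⟩⟩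
  | succ K ih =>
    obtain ⟨θ, hθ, h⟩ := ih
    have hp := hF Ψ hΨ (fun i => if i ≤ K ∧ K ≤ i + d then {K - i} else ∅) (by
      intro a b hab
      rw [Finset.disjoint_left]
      intro z
      by_cases ha : a ≤ K ∧ K ≤ a + d <;> by_cases hb : b ≤ K ∧ K ≤ b + d <;>
        simp only [ha, hb, if_false] <;> simp
      omega)
    refine ⟨_, F.mul_mem hθ hp, ?_⟩
    intro S m hm hS
    obtain ⟨hA, hB⟩ := h S m hm hS
    set V := S.biUnion (fun i => if i ≤ K ∧ K ≤ i + d then {K - i} else (∅ : Finset ℕ)) with hV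
    have memV : ∀ z, z ∈ V ↔ ∃ i ∈ S, i ≤ K ∧ K ≤ i + d ∧ z = K - i := by
      intro z
      simp only [hV, Finset.mem_biUnion]
      constructor
      · rintro ⟨i, hi, hz⟩
        refine ⟨i, hi, ?_⟩
        split_ifs at hz with hc
        · exact ⟨hc.1, hc.2, by simpa using hz⟩
        · simp at hz
      · rintro ⟨i, hi, a1, a2, a3⟩
        exact ⟨i, hi, by simp [a1, a2, a3]⟩
    have hVr : V ⊆ Finset.range (d + 1) := by
      intro z hz
      rw [memV] at hz
      obtain ⟨i, hi, a1, a2, a3⟩ := hz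
      simp; omega
    have h0 : 0 ∈ V ↔ K ∈ S := by
      rw [memV]
      constructor
      · rintro ⟨i, hi, a1, a2, a3⟩
        have : i = K := by omega
        exact this ▸ hi
      · intro hK; exact ⟨K, hK, by omega, by omega, by omega⟩
    obtain ⟨c1, c2, c3⟩ := hΨS V hVr
    simp only [Pi.mul_apply]
    rw [← hV]
    rcases lt_trichotomy K m with hlt | heq | hgt
    · have : K ∉ S := fun hK => by have := (hS K hK).1; omega
      refine ⟨fun _ => ?_, fun h => by omega⟩
      rw [hA (by omega), c1 (by rwa [h0])]; simp
    · subst heq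
      refine ⟨fun h => by omega, fun _ => ?_⟩
      rw [hA le_rfl, one_mul]
      apply c2
      ext z
      rw [memV, Finset.mem_singleton]
      constructor
      · rintro ⟨i, hi, a1, a2, a3⟩
        have := (hS i hi).1
        omega
      · rintro rfl
        exact ⟨K, hm, by omega, by omega, by omega⟩
    · refine ⟨fun h => by omega, fun _ => ?_⟩
      by_cases hK : K ∈ S
      · apply hBA _ (hB hgt)
        apply c3 (h0.2 hK)
        obtain ⟨l, hl, l1, l2⟩ := (hS K hK).2 (by omega)
        intro hV0
        have : K - l ∈ V := (memV _).2 ⟨l, hl, by omega, by omega, rfl⟩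
        rw [hV0] at this
        simp at this
        omega
      · rw [c1 (by rwa [h0]), mul_one]
        exact hB hgt
end AlgPart

section SemiPart
variable {Q : Type*} [Monoid Q] [TopologicalSpace Q]

/-- the enveloping semigroup -/
def EE (τ : ℤ → Q) : Set Q := closure (Set.range τ)

/-- IP-generators -/
def gen (τ : ℤ → Q) (n : ℕ → ℤ) : Finset ℕ → Q := fun S => τ (∑ i ∈ S, n i)

/-- the IP-enveloping semigroup -/
def IPE (τ : ℤ → Q) : Set (Finset ℕ → Q) := closure (Set.range (gen τ))

/-- standing assumptions -/
structure Good (τ : ℤ → Q) : Prop where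
  hr : ∀ r : Q, Continuous (· * r)
  h0 : τ 0 = 1
  hadd : ∀ m n, τ (m + n) = τ m * τ n
  hl : ∀ n, Continuous (τ n * ·)

variable {τ : ℤ → Q}

theorem Good.pi_r (h : Good τ) (r : Finset ℕ → Q) :
    Continuous (fun f : Finset ℕ → Q => f * r) :=
  continuous_pi fun S => (h.hr (r S)).comp (continuous_apply S)

theorem EE_mul (h : Good τ) {p q : Q} (hp : p ∈ EE τ) (hq : q ∈ EE τ) : p * q ∈ EE τ := by
  have h1 : ∀ n, τ n * q ∈ EE τ := fun n =>
    map_mem_closure (h.hl n) hq (by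
      rintro _ ⟨m, rfl⟩
      exact ⟨n + m, h.hadd n m⟩)
  have := map_mem_closure (h.hr q) hp (t := EE τ) (by
      rintro _ ⟨m, rfl⟩
      exact h1 m)
  rwa [EE, closure_closure] at this

theorem IPE_mul (h : Good τ) {p q : Finset ℕ → Q} (hp : p ∈ IPE τ) (hq : q ∈ IPE τ) :
    p * q ∈ IPE τ := by
  have h1 : ∀ n, gen τ n * q ∈ IPE τ := fun n =>
    map_mem_closure (f := fun q => gen τ n * q)
      (continuous_pi fun S => (h.hl _).comp (continuous_apply S)) hq (by
      rintro _ ⟨m, rfl⟩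
      refine ⟨n + m, ?_⟩
      funext S
      simp [gen, Finset.sum_add_distrib, h.hadd])
  have := map_mem_closure (h.pi_r q) hp (t := IPE τ) (by
      rintro _ ⟨m, rfl⟩
      exact h1 m)
  rwa [IPE, closure_closure] at this

theorem IPE_one (h : Good τ) : (1 : Finset ℕ → Q) ∈ IPE τ := by
  apply subset_closure
  exact ⟨0, by funext S; simp [gen, h.h0]⟩

theorem IPE_coord {θ : Finset ℕ → Q} (hθ : θ ∈ IPE τ) (S : Finset ℕ) : θ S ∈ EE τ :=
  map_mem_closure (f := fun θ : Finset ℕ → Q => θ S) (continuous_apply S) hθ (by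
    rintro _ ⟨n, rfl⟩
    exact ⟨_, rfl⟩)

theorem IPE_empty [T2Space Q] (h : Good τ) {θ : Finset ℕ → Q} (hθ : θ ∈ IPE τ) : θ ∅ = 1 := by
  have := map_mem_closure (t := {1}) (continuous_apply ∅) hθ (by
    rintro _ ⟨n, rfl⟩
    simp [gen, h.h0])
  simpa using this

theorem IPE_pull {θ : Finset ℕ → Q} (hθ : θ ∈ IPE τ) (C : ℕ → Finset ℕ)
    (hC : ∀ i j, i ≠ j → Disjoint (C i) (C j)) :
    (fun S : Finset ℕ => θ (S.biUnion C)) ∈ IPE τ :=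
  map_mem_closure (f := fun (θ : Finset ℕ → Q) (S : Finset ℕ) => θ (S.biUnion C))
    (continuous_pi fun S => continuous_apply _) hθ (by
    rintro _ ⟨n, rfl⟩
    refine ⟨fun j => ∑ i ∈ C j, n i, ?_⟩
    funext S
    simp only [gen]
    rw [Finset.sum_biUnion]
    intro i _ j _ hij
    exact hC i j hij)

theorem IPE_face (h : Good τ) {p : Q} (hp : p ∈ EE τ) (i : ℕ) :
    (fun S : Finset ℕ => if i ∈ S then p else 1) ∈ IPE τ :=
  map_mem_closure (f := fun (p : Q) (S : Finset ℕ) => if i ∈ S then p else 1)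
    (continuous_pi fun S => by
      by_cases hi : i ∈ S
      · simp only [hi, if_true]; exact continuous_id
      · simp only [hi, if_false]; exact continuous_const) hp (by
    rintro _ ⟨n, rfl⟩
    refine ⟨fun j => if j = i then n else 0, ?_⟩
    funext S
    simp only [gen, Finset.sum_ite_eq']
    split_ifs <;> simp [h.h0])

theorem IPE_idem (h : Good τ) {e : Q} (he : e ∈ EE τ) (hee : e * e = e) :
    (fun S : Finset ℕ => if S = ∅ then 1 else e) ∈ IPE τ := by
  have H : ∀ k : ℕ, (fun S : Finset ℕ => if ∃ i ∈ S, i < k then e else 1) ∈ IPE τ := by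
    intro k
    induction k with
    | zero =>
      convert IPE_one h using 1
      funext S
      simp
    | succ k ih =>
      convert IPE_mul h ih (IPE_face h he k) using 1
      funext S
      simp only [Pi.mul_apply]
      by_cases h1 : ∃ i ∈ S, i < k
      · have : ∃ i ∈ S, i < k + 1 := by
          obtain ⟨i, hi, hk⟩ := h1
          exact ⟨i, hi, by omega⟩
        rw [if_pos h1, if_pos this]
        split_ifs <;> simp [hee]
      · by_cases h2 : k ∈ S
        · rw [if_neg h1, if_pos ⟨k, h2, by omega⟩, if_pos h2, one_mul]
        · rw [if_neg h1, if_neg h2, if_neg, one_mul]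
          rintro ⟨i, hi, hk⟩
          rcases Nat.lt_succ_iff_lt_or_eq.1 hk with h3 | h3
          · exact h1 ⟨i, hi, h3⟩
          · exact h2 (h3 ▸ hi)
  refine isClosed_closure.mem_of_tendsto (b := atTop) (f := fun k : ℕ =>
    (fun S : Finset ℕ => if ∃ i ∈ S, i < k then e else 1)) ?_ (Eventually.of_forall H)
  rw [tendsto_pi_nhds]
  intro S
  apply tendsto_const_nhds.congr'
  by_cases hS : S = ∅
  · simp [hS, EventuallyEq]
  · obtain ⟨i, hi⟩ := Finset.nonempty_iff_ne_empty.2 hS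
    filter_upwards [eventually_gt_atTop i] with k hk
    rw [if_neg hS, if_pos ⟨i, hi, hk⟩]

/-- a minimal left ideal -/
structure MinIdeal (τ : ℤ → Q) (M : Set Q) : Prop where
  ne : M.Nonempty
  closed : IsClosed M
  sub : M ⊆ EE τ
  mul : ∀ p ∈ EE τ, ∀ m ∈ M, p * m ∈ M
  gen : ∀ u ∈ M, ∀ m ∈ M, ∃ p ∈ EE τ, p * u = m

theorem exists_minIdeal [CompactSpace Q] [T2Space Q] (h : Good τ) : ∃ M, MinIdeal τ M := by
  let Sf : Set (Set Q) := {N | IsClosed N ∧ N.Nonempty ∧ N ⊆ EE τ ∧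
    ∀ p ∈ EE τ, ∀ m ∈ N, p * m ∈ N}
  have hne : (EE τ).Nonempty := ⟨τ 0, subset_closure ⟨0, rfl⟩⟩
  have hE : EE τ ∈ Sf := ⟨isClosed_closure, hne, subset_rfl, fun p hp m hm => EE_mul h hp hm⟩
  obtain ⟨M, hM⟩ : ∃ N', Minimal (· ∈ Sf) N' := by
    refine zorn_superset _ fun c hcs hc => ?_
    obtain rfl | hcnemp := c.eq_empty_or_nonempty
    · exact ⟨EE τ, hE, by simp⟩
    refine ⟨⋂₀ c, ⟨isClosed_sInter fun t ht => (hcs ht).1, ?_, ?_, ?_⟩, fun s hs =>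
      Set.sInter_subset_of_mem hs⟩
    · rw [Set.sInter_eq_iInter]
      have := hcnemp.coe_sort
      apply IsCompact.nonempty_iInter_of_directed_nonempty_isCompact_isClosed
      · exact DirectedOn.directed_val (IsChain.directedOn hc.symm)
      exacts [fun i => (hcs i.prop).2.1, fun i => (hcs i.prop).1.isCompact,
        fun i => (hcs i.prop).1]
    · obtain ⟨t, ht⟩ := hcnemp
      exact (Set.sInter_subset_of_mem ht).trans (hcs ht).2.2.1
    · intro p hp m hm
      rw [Set.mem_sInter] at hm ⊢
      exact fun t ht => (hcs ht).2.2.2 p hp m (hm t ht)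
  obtain ⟨h1, h2, h3, h4⟩ := hM.prop
  refine ⟨M, h2, h1, h3, h4, ?_⟩
  intro u hu m hm
  have : (· * u) '' EE τ = M := by
    apply hM.eq_of_subset
    · refine ⟨((isClosed_closure.isCompact).image (h.hr u)).isClosed, hne.image _, ?_, ?_⟩
      · rintro _ ⟨p, hp, rfl⟩
        exact EE_mul h hp (h3 hu)
      · rintro p hp _ ⟨q, hq, rfl⟩
        exact ⟨p * q, EE_mul h hp hq, mul_assoc _ _ _⟩
    · rintro _ ⟨p, hp, rfl⟩
      exact h4 p hp u hu
  rw [← this] at hm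
  exact hm

theorem MinIdeal.mul_idem {M : Set Q} (hM : MinIdeal τ M) {u m : Q} (hu : u ∈ M)
    (huu : u * u = u) (hm : m ∈ M) : m * u = m := by
  obtain ⟨p, _, rfl⟩ := hM.gen u hu m hm
  rw [mul_assoc, huu]

/-- the group `eM` -/
def GG (M : Set Q) (e : Q) : Type _ := {g : Q // g ∈ M ∧ e * g = g}

/-- data for the group -/
structure GData (τ : ℤ → Q) (M : Set Q) (e : Q) : Prop where
  good : Good τ
  ideal : MinIdeal τ M
  mem : e ∈ M
  idem : e * e = e

theorem GG_mem {M : Set Q} {e : Q} (H : GData τ M e) {p : Q} (hp : p ∈ EE τ) {m : Q}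
    (hm : m ∈ M) : e * p * m ∈ M ∧ e * (e * p * m) = e * p * m := by
  refine ⟨H.ideal.mul _ (EE_mul H.good (H.ideal.sub H.mem) hp) _ hm, ?_⟩
  rw [← mul_assoc, ← mul_assoc, H.idem]

/-- group structure on `eM` -/
@[reducible]
noncomputable def GGgroup {M : Set Q} {e : Q} (H : GData τ M e) : Group (GG M e) :=
  letI : Mul (GG M e) := ⟨fun a b => ⟨a.1 * b.1,
    H.ideal.mul _ (H.ideal.sub a.2.1) _ b.2.1, by rw [← mul_assoc, a.2.2]⟩⟩
  letI : One (GG M e) := ⟨⟨e, H.mem, H.idem⟩⟩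
  have hex : ∀ a : GG M e, ∃ b : GG M e, b * a = 1 := fun a => by
    obtain ⟨p, hp, hpe⟩ := H.ideal.gen a.1 a.2.1 e H.mem
    refine ⟨⟨e * p * e, GG_mem H hp H.mem⟩, Subtype.ext ?_⟩
    change e * p * e * a.1 = e
    rw [mul_assoc, a.2.2, mul_assoc, hpe, H.idem]
  letI : Inv (GG M e) := ⟨fun a => (hex a).choose⟩
  Group.ofLeftAxioms (fun a b c => Subtype.ext (mul_assoc _ _ _))
    (fun a => Subtype.ext a.2.2) (fun a => (hex a).choose_spec)

variable [CompactSpace Q] [T2Space Q]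

/-- the IP group -/
noncomputable def FF {M : Set Q} {e : Q} (H : GData τ M e) :
    letI := GGgroup H
    Subgroup (Finset ℕ → GG M e) :=
  letI := GGgroup H
  { carrier := {φ | φ ∅ = 1 ∧ ∃ θ ∈ IPE τ, ∀ S, S ≠ ∅ → (φ S).1 = θ S}
    mul_mem' := by
      rintro a b ⟨ha, θ, hθ, h1⟩ ⟨hb, η, hη, h2⟩
      refine ⟨by simp [ha, hb], θ * η, IPE_mul H.good hθ hη, fun S hS => ?_⟩
      change (a S).1 * (b S).1 = θ S * η S
      rw [h1 S hS, h2 S hS]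
    one_mem' := by
      refine ⟨rfl, _, IPE_idem H.good (H.ideal.sub H.mem) H.idem, fun S hS => ?_⟩
      rw [if_neg hS]
      rfl
    inv_mem' := by
      rintro a ⟨ha, θ, hθ, h1⟩
      refine ⟨by simp [ha], ?_⟩
      obtain ⟨u, ⟨η, hη, hηu⟩, hu⟩ := exists_idempotent_in_compact_subsemigroup H.good.pi_r
        ((fun f => f * θ) '' IPE τ) (Set.Nonempty.image _ ⟨_, IPE_one H.good⟩)
        ((isClosed_closure.isCompact).image (H.good.pi_r θ)) (by
          rintro _ ⟨p, hp, rfl⟩ _ ⟨q, hq, rfl⟩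
          exact ⟨p * θ * q, IPE_mul H.good (IPE_mul H.good hp hθ) hq, by simp [mul_assoc]⟩)
      have hh := IPE_idem H.good (H.ideal.sub H.mem) H.idem
      refine ⟨_, IPE_mul H.good (IPE_mul H.good hh hη) hh, fun S hS => ?_⟩
      simp only [Pi.mul_apply, if_neg hS, Pi.inv_apply]
      have hηE := IPE_coord hη S
      let b : GG M e := ⟨e * η S * e, GG_mem H hηE H.mem⟩
      have : b = (a S)⁻¹ := by
        apply eq_inv_of_mul_eq_one_left
        apply Subtype.ext
        change e * η S * e * (a S).1 = e
        rw [mul_assoc, (a S).2.2, mul_assoc, h1 S hS]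
        have h3 : η S * θ S = u S := by rw [← hηu]; rfl
        rw [h3]
        apply H.ideal.mul_idem _ (congrFun hu S) H.mem
        rw [← h3, ← h1 S hS]
        exact H.ideal.mul _ hηE _ (a S).2.1
      rw [← this] }

theorem FF_pull {M : Set Q} {e : Q} (H : GData τ M e) :
    letI := GGgroup H
    PullClosed (FF H) := by
  letI := GGgroup H
  rintro φ ⟨h0, θ, hθ, h1⟩ C hC
  refine ⟨by simpa using h0, ?_⟩
  have hh := IPE_idem H.good (H.ideal.sub H.mem) H.idem
  refine ⟨_, IPE_mul H.good (IPE_mul H.good hh (IPE_pull hθ C hC)) hh, fun S hS => ?_⟩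
  simp only [Pi.mul_apply, if_neg hS]
  by_cases hU : S.biUnion C = ∅
  · rw [hU, h0, IPE_empty H.good hθ, mul_one, H.idem]
    rfl
  · rw [← h1 _ hU, (φ _).2.2, H.ideal.mul_idem H.mem H.idem (φ _).2.1]

theorem FF_mk {M : Set Q} {e e₁ : Q} (H : GData τ M e) (he₁ : e₁ ∈ M) (he : e₁ * e₁ = e₁)
    {θ : Finset ℕ → Q} (hθ : θ ∈ IPE τ) :
    letI := GGgroup H
    ∃ φ ∈ FF H, ∀ S, S ≠ ∅ → (φ S).1 = e * θ S * e₁ := by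
  letI := GGgroup H
  have hh := IPE_idem H.good (H.ideal.sub H.mem) H.idem
  have hh₁ := IPE_idem H.good (H.ideal.sub he₁) he
  refine ⟨fun S => if S = ∅ then 1 else ⟨e * θ S * e₁, GG_mem H (IPE_coord hθ S) he₁⟩,
    ⟨by simp, _, IPE_mul H.good (IPE_mul H.good hh hθ) hh₁, fun S hS => ?_⟩, fun S hS => ?_⟩
  · simp [hS]
  · simp [hS]
end SemiPart

section TopPart

theorem zIter_zero {X : Type*} (T : Equiv.Perm X) : zIter T 0 = id := by
  funext z; simp [zIter]

theorem zIter_add {X : Type*} (T : Equiv.Perm X) (m n : ℤ) (z : X) :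
    zIter T (m + n) z = zIter T m (zIter T n z) := by
  simp [zIter, zpow_add]

theorem zIter_one {X : Type*} (T : Equiv.Perm X) : zIter T 1 = T := by
  funext z; simp [zIter]

theorem zIter_neg_one {X : Type*} (T : Equiv.Perm X) : zIter T (-1) = T.symm := by
  funext z; simp [zIter]

theorem hIter_zero {X : Type*} [TopologicalSpace X] (T : X ≃ₜ X) : hIter T 0 = id :=
  zIter_zero _

theorem hIter_add {X : Type*} [TopologicalSpace X] (T : X ≃ₜ X) (m n : ℤ) (z : X) :
    hIter T (m + n) z = hIter T m (hIter T n z) := zIter_add _ _ _ _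

theorem hIter_continuous {X : Type*} [TopologicalSpace X] (T : X ≃ₜ X) (n : ℤ) :
    Continuous (hIter T n) := by
  induction n using Int.induction_on with
  | zero => rw [hIter_zero]; exact continuous_id
  | succ n ih =>
    have : hIter T ((n : ℤ) + 1) = hIter T n ∘ T := by
      funext z
      rw [hIter_add]
      simp only [hIter, zIter_one, Function.comp]
      rfl
    rw [this]; exact ih.comp T.continuous
  | pred n ih =>
    have : hIter T (-(n : ℤ) - 1) = hIter T (-n) ∘ T.symm := by
      funext z
      rw [sub_eq_add_neg, hIter_add]
      simp only [hIter, zIter_neg_one, Function.comp]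
      rfl
    rw [this]; exact ih.comp T.symm.continuous

/-- pointwise topology -/
local instance endTop {X : Type*} [TopologicalSpace X] : TopologicalSpace (Function.End X) :=
  inferInstanceAs (TopologicalSpace (X → X))

local instance endCompact {X : Type*} [TopologicalSpace X] [CompactSpace X] :
    CompactSpace (Function.End X) :=
  inferInstanceAs (CompactSpace (X → X))

local instance endT2 {X : Type*} [TopologicalSpace X] [T2Space X] :
    T2Space (Function.End X) :=
  inferInstanceAs (T2Space (X → X))

theorem end_eval {X : Type*} [TopologicalSpace X] (z : X) :
    Continuous (fun f : Function.End X => f z) :=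
  continuous_apply (A := fun _ : X => X) z

theorem end_pi {X Y : Type*} [TopologicalSpace X] [TopologicalSpace Y] {F : Y → Function.End X}
    (h : ∀ z, Continuous (fun a => F a z)) : Continuous F :=
  continuous_pi (A := fun _ : X => X) h

variable {X : Type*} [MetricSpace X] [CompactSpace X]

/-- the action as elements of the full monoid -/
def tauE (T : X ≃ₜ X) (n : ℤ) : Function.End X := hIter T n

theorem tauE_good (T : X ≃ₜ X) : Good (tauE T) where
  hr r := end_pi fun z => end_eval (r z)
  h0 := hIter_zero T
  hadd m n := funext fun z => hIter_add T m n z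
  hl n := end_pi fun z => (hIter_continuous T n).comp (end_eval z)

theorem exists_fix (T : X ≃ₜ X) (hmin : MinimalTDS T) {M : Set (Function.End X)}
    (hM : MinIdeal (tauE T) M) (z : X) : ∃ u ∈ M, u * u = u ∧ u z = z := by
  obtain ⟨m, hm⟩ := hM.ne
  have hclosed : IsClosed ((fun f : Function.End X => f (m z)) '' EE (tauE T)) :=
    ((isClosed_closure.isCompact).image (end_eval (m z))).isClosed
  have huniv : ((fun f : Function.End X => f (m z)) '' EE (tauE T)) = Set.univ := by
    rw [← hclosed.closure_eq]
    apply Dense.closure_eq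
    apply (hmin (m z)).mono
    rintro _ ⟨n, rfl⟩
    exact ⟨tauE T n, subset_closure ⟨n, rfl⟩, rfl⟩
  obtain ⟨p, hp, hpz⟩ : z ∈ ((fun f : Function.End X => f (m z)) '' EE (tauE T)) := by
    rw [huniv]; trivial
  obtain ⟨u, ⟨hu1, hu2⟩, huu⟩ := exists_idempotent_in_compact_subsemigroup (tauE_good T).hr
    (M ∩ {f | f z = z}) ⟨p * m, hM.mul p hp m hm, hpz⟩
    (hM.closed.inter ((isClosed_singleton (x := z)).preimage (end_eval z))).isCompact (by
      rintro f ⟨hf1, hf2⟩ g ⟨hg1, hg2⟩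
      refine ⟨hM.mul f (hM.sub hf1) g hg1, ?_⟩
      change f (g z) = z
      have hf2 : f z = z := hf2
      have hg2 : g z = z := hg2
      rw [hg2, hf2])
  exact ⟨u, hu1, huu, hu2⟩

theorem rp_seq (T : X ≃ₜ X) (hmin : MinimalTDS T) (d : ℕ) (x y : X) (h : RPd T d x y)
    (δ : ℝ) (hδ : 0 < δ) : ∃ N : ℕ → ℤ,
      dist x (hIter T (∑ i ∈ {d + 1}, N i) x) < δ ∧
      dist y (hIter T (∑ i ∈ {0, d + 1}, N i) x) < δ ∧
      ∀ ε : Finset ℕ, ε ⊆ Finset.Icc 1 d → ε.Nonempty →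
        dist (hIter T (∑ i ∈ insert (d + 1) ε, N i) x)
          (hIter T (∑ i ∈ insert (d + 1) (insert 0 ε), N i) x) < δ := by
  obtain ⟨x', y', n, h1, h2, h3⟩ := h δ hδ
  obtain ⟨m, hm1, hm2⟩ : ∃ m : ℤ, dist x (hIter T m x) < δ ∧
      ∀ ε : Finset (Fin d), ε.Nonempty → dist (hIter T (∑ i ∈ ε, n i) (hIter T m x))
        (hIter T (∑ i ∈ ε, n i) y') < δ := by
    have ho : IsOpen ({z | dist x z < δ} ∩ ⋂ ε : {ε : Finset (Fin d) // ε.Nonempty},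
        {z | dist (hIter T (∑ i ∈ ε.1, n i) z) (hIter T (∑ i ∈ ε.1, n i) y') < δ}) := by
      apply IsOpen.inter
      · exact isOpen_lt (continuous_const.dist continuous_id) continuous_const
      · exact isOpen_iInter_of_finite fun ε =>
          isOpen_lt ((hIter_continuous T _).dist continuous_const) continuous_const
    obtain ⟨_, ⟨ha, hb⟩, ⟨m, rfl⟩⟩ := (hmin x).inter_open_nonempty _ ho
      ⟨x', h1, Set.mem_iInter.2 fun ε => h3 ε.1 ε.2⟩
    exact ⟨m, ha, fun ε hε => Set.mem_iInter.1 hb ⟨ε, hε⟩⟩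
  obtain ⟨k, hk1, hk2⟩ : ∃ k : ℤ, dist y (hIter T k x) < δ ∧
      ∀ ε : Finset (Fin d), ε.Nonempty → dist (hIter T (∑ i ∈ ε, n i) (hIter T m x))
        (hIter T (∑ i ∈ ε, n i) (hIter T k x)) < δ := by
    have ho : IsOpen ({z | dist y z < δ} ∩ ⋂ ε : {ε : Finset (Fin d) // ε.Nonempty},
        {z | dist (hIter T (∑ i ∈ ε.1, n i) (hIter T m x))
          (hIter T (∑ i ∈ ε.1, n i) z) < δ}) := by
      apply IsOpen.inter
      · exact isOpen_lt (continuous_const.dist continuous_id) continuous_const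
      · exact isOpen_iInter_of_finite fun ε =>
          isOpen_lt (continuous_const.dist (hIter_continuous T _)) continuous_const
    obtain ⟨_, ⟨ha, hb⟩, ⟨m, rfl⟩⟩ := (hmin x).inter_open_nonempty _ ho
      ⟨y', h2, Set.mem_iInter.2 fun ε => hm2 ε.1 ε.2⟩
    exact ⟨m, ha, fun ε hε => Set.mem_iInter.1 hb ⟨ε, hε⟩⟩
  let N : ℕ → ℤ := fun i => if i = 0 then k - m else if hi : i - 1 < d then n ⟨i - 1, hi⟩ else m
  have N0 : N 0 = k - m := by simp [N]
  have Nr : N (d + 1) = m := by simp [N]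
  refine ⟨N, ?_, ?_, ?_⟩
  · rw [Finset.sum_singleton, Nr]; exact hm1
  · rw [Finset.sum_pair (by omega), Nr, N0, sub_add_cancel]; exact hk1
  · intro ε hε hne
    have hr : d + 1 ∉ ε := fun h => by have := hε h; simp at this
    have h0 : 0 ∉ ε := fun h => by have := hε h; simp at this
    have hr' : d + 1 ∉ insert 0 ε := by
      rw [Finset.mem_insert]; rintro (h | h)
      · omega
      · exact hr h
    rw [Finset.sum_insert hr, Finset.sum_insert hr', Finset.sum_insert h0, Nr, N0]
    have hs : ∑ i ∈ ε, N i = ∑ i ∈ Finset.univ.filter (fun i : Fin d => (i : ℕ) + 1 ∈ ε), n i := by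
      symm
      apply Finset.sum_bij (fun (i : Fin d) _ => (i : ℕ) + 1)
      · intro a ha; simpa using ha
      · intro a _ b _ hab; exact Fin.ext (by omega)
      · intro b hb
        have := Finset.mem_Icc.1 (hε hb)
        refine ⟨⟨b - 1, by omega⟩, ?_, ?_⟩
        · simp only [Finset.mem_filter, Finset.mem_univ, true_and]
          rwa [Nat.sub_add_cancel this.1]
        · exact Nat.sub_add_cancel this.1
      · intro a ha
        simp [N]
    have hne' : (Finset.univ.filter (fun i : Fin d => (i : ℕ) + 1 ∈ ε)).Nonempty := by
      obtain ⟨b, hb⟩ := hne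
      have := Finset.mem_Icc.1 (hε hb)
      refine ⟨⟨b - 1, by omega⟩, ?_⟩
      simp only [Finset.mem_filter, Finset.mem_univ, true_and]
      rwa [Nat.sub_add_cancel this.1]
    have := hk2 _ hne'
    rw [← hs, ← hIter_add, ← hIter_add] at this
    convert this using 3 <;> ring

theorem rp_limit (T : X ≃ₜ X) (hmin : MinimalTDS T) (d : ℕ) (x y : X) (h : RPd T d x y) :
    ∃ θ ∈ IPE (tauE T), θ {d + 1} x = x ∧ θ {0, d + 1} x = y ∧
      ∀ ε : Finset ℕ, ε ⊆ Finset.Icc 1 d → ε.Nonempty →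
        θ (insert (d + 1) ε) x = θ (insert (d + 1) (insert 0 ε)) x := by
  choose N h1 h2 h3 using fun j : ℕ => rp_seq T hmin d x y h (1 / ((j : ℝ) + 1)) (by positivity)
  let 𝒰 : Ultrafilter ℕ := hyperfilter ℕ
  let f : ℕ → Finset ℕ → Function.End X := fun j => gen (tauE T) (N j)
  obtain ⟨θ, -, hθ⟩ := isCompact_univ.ultrafilter_le_nhds (𝒰.map f) (by simp)
  have hθ : Tendsto f 𝒰 (𝓝 θ) := hθ
  have hc : ∀ S, Tendsto (fun j => hIter T (∑ i ∈ S, N j i) x) 𝒰 (𝓝 (θ S x)) := by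
    intro S
    exact ((end_eval x).comp (continuous_apply (A := fun _ => Function.End X) S)).continuousAt.tendsto.comp hθ
  have hz : Tendsto (fun j : ℕ => 1 / ((j : ℝ) + 1)) 𝒰 (𝓝 0) :=
    tendsto_one_div_add_atTop_nhds_zero_nat.mono_left (Nat.hyperfilter_le_atTop)
  refine ⟨θ, ?_, ?_, ?_, ?_⟩
  · exact mem_closure_of_tendsto hθ (Eventually.of_forall fun j => ⟨N j, rfl⟩)
  · have := le_of_tendsto_of_tendsto (tendsto_const_nhds.dist (hc {d + 1})) hz
      (Eventually.of_forall fun j => (h1 j).le)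
    exact (dist_le_zero.1 this).symm
  · have := le_of_tendsto_of_tendsto (tendsto_const_nhds.dist (hc {0, d + 1})) hz
      (Eventually.of_forall fun j => (h2 j).le)
    exact (dist_le_zero.1 this).symm
  · intro ε hε hne
    have := le_of_tendsto_of_tendsto ((hc (insert (d + 1) ε)).dist
      (hc (insert (d + 1) (insert 0 ε)))) hz
      (Eventually.of_forall fun j => (h3 j ε hε hne).le)
    exact dist_le_zero.1 this

theorem top_main (T : X ≃ₜ X) (hmin : MinimalTDS T) (d : ℕ) (x y : X) (h : RPd T d x y)
    (U : Set X) (hU : IsOpen U) (hy : y ∈ U) (K : ℕ) :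
    ∃ p : ℕ → ℤ, ∀ S ⊆ Finset.range K, GapOK d S → hIter T (∑ i ∈ S, p i) x ∈ U := by
  obtain ⟨Θ', hΘ', t1, t2, t3⟩ := rp_limit T hmin d x y h
  obtain ⟨M, hM⟩ := exists_minIdeal (tauE_good T)
  obtain ⟨e, heM, hee, hey⟩ := exists_fix T hmin hM y
  obtain ⟨e₁, he₁M, he₁, he₁x⟩ := exists_fix T hmin hM x
  have H : GData (tauE T) M e := ⟨tauE_good T, hM, heM, hee⟩
  letI := GGgroup H
  obtain ⟨Φ, hΦ, hΦS⟩ := FF_mk H he₁M he₁ hΘ'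
  have hΦx : ∀ S, S ≠ ∅ → (Φ S).1 x = e (Θ' S x) := by
    intro S hS
    rw [hΦS S hS]
    change e (Θ' S (e₁ x)) = _
    rw [he₁x]
  have mulx : ∀ a b : GG M e, (a * b).1 x = a.1 (b.1 x) := fun a b => rfl
  have onex : (1 : GG M e).1 x = e x := rfl
  have ge : ∀ a : GG M e, a.1 (e x) = a.1 x := fun a => by
    change (a * 1).1 x = _
    rw [mul_one]
  let A : Subgroup (GG M e) :=
    { carrier := {g | g.1 x = e x}
      mul_mem' := by
        intro a b (ha : a.1 x = e x) (hb : b.1 x = e x)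
        change (a * b).1 x = e x
        rw [mulx, hb, ge, ha]
      one_mem' := onex
      inv_mem' := by
        intro a (ha : a.1 x = e x)
        change (a⁻¹).1 x = e x
        rw [← ge, ← ha, ← mulx, inv_mul_cancel, onex, ha] }
  let B : Set (GG M e) := {g | g.1 x = y}
  obtain ⟨θ, ⟨-, η, hη, hθη⟩, hθ⟩ := alg_step4 (FF H) (FF_pull H) (fun φ hφ => hφ.1) A B (by
      intro b (hb : b.1 x = y) a (ha : a.1 x = e x)
      change (b * a).1 x = y
      rw [mulx, ha, ge, hb]) d Φ hΦ (by
      change (Φ _).1 x = e x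
      rw [hΦx _ (by simp), t1]) (by
      change (Φ _).1 x = y
      rw [hΦx _ (by simp), t2, hey]) (by
      intro ε hε hne
      change ((Φ _)⁻¹ * Φ _).1 x = e x
      rw [mulx, hΦx (insert (d + 1) (insert 0 ε)) (by simp), ← t3 ε hε hne,
        ← hΦx _ (by simp), ← mulx, inv_mul_cancel, onex]) K
  have ho : IsOpen (⋂ S : {S // S ∈ (Finset.range K).powerset ∧ GapOK d S},
      {f : Finset ℕ → Function.End X | f S.1 x ∈ U}) := by
    haveI : Finite {S // S ∈ (Finset.range K).powerset ∧ GapOK d S} :=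
      Set.Finite.to_subtype ((Finset.finite_toSet (Finset.range K).powerset).subset
        fun S hS => hS.1)
    apply isOpen_iInter_of_finite
    intro S
    exact hU.preimage ((end_eval x).comp (continuous_apply (A := fun _ => Function.End X) S.1))
  obtain ⟨_, hf, ⟨p, rfl⟩⟩ := mem_closure_iff.1 hη _ ho (by
    rw [Set.mem_iInter]
    rintro ⟨S, hS, hG⟩
    have hne : S ≠ ∅ := by
      rintro rfl
      obtain ⟨m, hm, _⟩ := hG
      simp at hm
    have h1 : (θ S).1 x = y := hθ S (Finset.mem_powerset.1 hS) hG
    rw [hθη S hne] at h1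
    change η S x ∈ U
    rwa [h1])
  refine ⟨p, fun S hS hG => ?_⟩
  exact Set.mem_iInter.1 hf ⟨S, Finset.mem_powerset.2 hS, hG⟩

end TopPart

section MeasPart

theorem pair_lemma {Y : Type*} [MeasurableSpace Y] (ν : Measure Y) [IsProbabilityMeasure ν]
    (B : ℕ → Set Y) (hB : ∀ m, MeasurableSet (B m)) (c : ℝ) (N : ℕ) (hc : ∀ m, c ≤ ν.real (B m))
    (hN : 2 < N * c) : ∃ m m', m < m' ∧ m' < N ∧ 1 / (N : ℝ) ^ 2 ≤ ν.real (B m ∩ B m') := by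
  by_contra! hcon
  have hNpos : (0 : ℝ) < N := by
    rcases Nat.eq_zero_or_pos N with h | h
    · simp [h] at hN; linarith
    · exact_mod_cast h
  have key : ∀ k ≤ N, k * c - k / N ≤ ν.real (⋃ m ∈ Finset.range k, B m) := by
    intro k hk
    induction k with
    | zero => simp
    | succ k ih =>
      have ih := ih (by omega)
      have hU : (⋃ m ∈ Finset.range (k + 1), B m) = B k ∪ ⋃ m ∈ Finset.range k, B m := by
        rw [Finset.range_add_one, Finset.set_biUnion_insert]
      rw [hU]
      have h1 := measureReal_union_add_inter (μ := ν) (s := B k)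
        (t := ⋃ m ∈ Finset.range k, B m) (Finset.measurableSet_biUnion _ fun m _ => hB m)
        (measure_ne_top _ _) (measure_ne_top _ _)
      have h2 : ν.real (B k ∩ ⋃ m ∈ Finset.range k, B m) ≤ 1 / N := by
        rw [Set.inter_iUnion₂]
        calc ν.real (⋃ m ∈ Finset.range k, B k ∩ B m)
            ≤ ∑ m ∈ Finset.range k, ν.real (B k ∩ B m) :=
              measureReal_biUnion_finset_le _ _
          _ ≤ ∑ m ∈ Finset.range k, 1 / (N : ℝ) ^ 2 := by
              apply Finset.sum_le_sum
              intro m hm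
              rw [Set.inter_comm]
              exact (hcon m k (Finset.mem_range.1 hm) (by omega)).le
          _ = k * (1 / (N : ℝ) ^ 2) := by simp
          _ ≤ N * (1 / (N : ℝ) ^ 2) := by
              gcongr
              omega
          _ = 1 / N := by field_simp
      have h3 := hc k
      push_cast
      rw [add_div]
      linarith
  have := key N le_rfl
  have h1 : ν.real (⋃ m ∈ Finset.range N, B m) ≤ 1 := measureReal_le_one
  rw [div_self hNpos.ne'] at this
  linarith

theorem zIter_mp {Y : Type*} [MeasurableSpace Y] {ν : Measure Y} (T : Y ≃ᵐ Y)
    (hT : MeasurePreserving T ν ν) (n : ℤ) : MeasurePreserving (zIter T.toEquiv n) ν ν := by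
  induction n using Int.induction_on with
  | zero => rw [zIter_zero]; exact MeasurePreserving.id ν
  | succ n ih =>
    have : zIter T.toEquiv ((n : ℤ) + 1) = zIter T.toEquiv n ∘ T := by
      funext z
      rw [zIter_add, zIter_one]
      rfl
    rw [this]; exact ih.comp hT
  | pred n ih =>
    have : zIter T.toEquiv (-(n : ℤ) - 1) = zIter T.toEquiv (-n) ∘ T.symm := by
      funext z
      rw [sub_eq_add_neg, zIter_add, zIter_neg_one]
      rfl
    rw [this]; exact ih.comp (hT.symm T)

theorem ph_lemma {Y : Type*} [MeasurableSpace Y] (ν : Measure Y) [IsProbabilityMeasure ν]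
    (T : Y ≃ᵐ Y) (hT : MeasurePreserving T ν ν) (t : ℕ) : ∀ c : ℝ, 0 < c → ∃ L : ℕ,
    ∀ A : Set Y, MeasurableSet A → c ≤ ν.real A → ∀ (p : ℕ → ℕ → ℤ) (a0 : ℕ),
    ∃ a b : ℕ → ℕ, (∀ i < t, a0 ≤ a i ∧ a i < b i ∧ b i ≤ a0 + L) ∧
      (∀ i j, i < j → j < t → a i ≤ a j ∧ b j ≤ b i) ∧
      0 < ν.real {ω | ∀ ε : ℕ → Bool, zIter T.toEquiv (∑ i ∈ Finset.range t,
        if ε i then ∑ j ∈ Finset.Ico (a i) (b i), p i j else 0) ω ∈ A} := by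
  induction t with
  | zero =>
    intro c hc
    refine ⟨0, fun A hA hcA p a0 => ⟨fun _ => 0, fun _ => 0, by simp, by simp, ?_⟩⟩
    simp only [Finset.range_zero, Finset.sum_empty, zIter_zero, id, forall_const]
    exact lt_of_lt_of_le hc hcA
  | succ t ih =>
    intro c hc
    obtain ⟨N, hN⟩ := exists_nat_gt (2 / c)
    have hN2 : 2 < N * c := by rwa [div_lt_iff₀ hc] at hN
    have hNpos : (0 : ℝ) < N := lt_trans (by positivity) hN
    obtain ⟨L', hL'⟩ := ih (1 / (N : ℝ) ^ 2) (by positivity)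
    set w := L' + 1 with hw
    refine ⟨N * w, fun A hA hcA p a0 => ?_⟩
    let s : ℕ → ℤ := fun m => ∑ j ∈ Finset.Ico a0 (a0 + m * w), p 0 j
    have hmp := zIter_mp T hT
    obtain ⟨m, m', hmm, hm'N, hpair⟩ := pair_lemma ν (fun m => zIter T.toEquiv (s m) ⁻¹' A)
      (fun m => (hmp _).measurable hA) c N (fun m => by
        rw [(hmp _).measureReal_preimage hA.nullMeasurableSet]; exact hcA) hN2
    have hmw : m * w + w ≤ m' * w := by
      have : (m + 1) * w ≤ m' * w := Nat.mul_le_mul_right _ hmm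
      linarith [add_mul m 1 w]
    have hm'w : m' * w ≤ N * w := Nat.mul_le_mul_right _ hm'N.le
    set n0 : ℤ := ∑ j ∈ Finset.Ico (a0 + m * w) (a0 + m' * w), p 0 j with hn0
    have hs : s m' = n0 + s m := by
      simp only [s, hn0]
      have := Finset.sum_Ico_consecutive (p 0) (show a0 ≤ a0 + m * w by omega)
        (show a0 + m * w ≤ a0 + m' * w by omega)
      rw [← this, add_comm]
    have hA' : MeasurableSet (A ∩ zIter T.toEquiv n0 ⁻¹' A) := hA.inter ((hmp _).measurable hA)
    have hcA' : 1 / (N : ℝ) ^ 2 ≤ ν.real (A ∩ zIter T.toEquiv n0 ⁻¹' A) := by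
      rw [← (hmp (s m)).measureReal_preimage hA'.nullMeasurableSet]
      convert hpair using 2
      ext ω
      simp only [Set.mem_preimage, Set.mem_inter_iff, hs, zIter_add]
    obtain ⟨a, b, h1, h2, h3⟩ := hL' _ hA' hcA' (fun i => p (i + 1)) (a0 + m * w)
    refine ⟨fun i => Nat.casesOn i (a0 + m * w) a, fun i => Nat.casesOn i (a0 + m' * w) b,
      ?_, ?_, ?_⟩
    · intro i hi
      cases i with
      | zero =>
        change a0 ≤ a0 + m * w ∧ a0 + m * w < a0 + m' * w ∧ a0 + m' * w ≤ a0 + N * w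
        omega
      | succ i =>
        obtain ⟨q1, q2, q3⟩ := h1 i (by omega)
        change a0 ≤ a i ∧ a i < b i ∧ b i ≤ a0 + N * w
        omega
    · intro i j hij hj
      cases j with
      | zero => omega
      | succ j =>
        cases i with
        | zero =>
          obtain ⟨q1, q2, q3⟩ := h1 j (by omega)
          change a0 + m * w ≤ a j ∧ b j ≤ a0 + m' * w
          omega
        | succ i => exact h2 i j (by omega) (by omega)
    · refine lt_of_lt_of_le h3 (measureReal_mono ?_)
      intro ω hω ε
      have := hω (fun i => ε (i + 1))
      rw [Finset.sum_range_succ']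
      obtain ⟨g1, g2⟩ := this
      cases hε : ε 0 with
      | false => simpa using g1
      | true =>
        have g2 : zIter T.toEquiv n0 _ ∈ A := g2
        rw [← zIter_add] at g2
        rw [add_comm]
        simpa using g2

theorem gap_set (d : ℕ) (hd : 1 ≤ d) (a b : ℕ → ℕ) (L : ℕ)
    (h1 : ∀ i < d, 0 ≤ a i ∧ a i < b i ∧ b i ≤ 0 + L)
    (h2 : ∀ i j, i < j → j < d → a i ≤ a j ∧ b j ≤ b i) (P : ℕ → ℤ)
    (I : Finset (Fin d)) (hI : I.Nonempty) :
    ∃ S ⊆ Finset.range (L * d), GapOK d S ∧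
      ∑ i ∈ I, ∑ j ∈ Finset.Ico (a i) (b i), P (j * d + i) = ∑ k ∈ S, P k := by
  let F : (Σ _ : Fin d, ℕ) → ℕ := fun q => q.2 * d + q.1
  let Q : Finset (Σ _ : Fin d, ℕ) := I.sigma fun i => Finset.Ico (a i) (b i)
  have hF : Function.Injective F := by
    rintro ⟨i, j⟩ ⟨i', j'⟩ h
    simp only [F] at h
    have e1 : (i : ℕ) = i' := by
      have := congrArg (· % d) h
      simpa [Nat.mod_eq_of_lt i.2, Nat.mod_eq_of_lt i'.2] using this
    have e2 : j = j' := by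
      rw [e1] at h
      exact Nat.eq_of_mul_eq_mul_right (by omega) (Nat.add_right_cancel h)
    have e3 : i = i' := Fin.ext e1
    subst e2 e3
    rfl
  have hmem : ∀ k, k ∈ Q.image F ↔ ∃ i ∈ I, ∃ j, a i ≤ j ∧ j < b i ∧ k = j * d + i := by
    intro k
    simp only [Finset.mem_image, Q, Finset.mem_sigma, Finset.mem_Ico, F]
    constructor
    · rintro ⟨⟨i, j⟩, ⟨hi, hj1, hj2⟩, rfl⟩
      exact ⟨i, hi, j, hj1, hj2, rfl⟩
    · rintro ⟨i, hi, j, hj1, hj2, rfl⟩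
      exact ⟨⟨i, j⟩, ⟨hi, hj1, hj2⟩, rfl⟩
  refine ⟨Q.image F, ?_, ?_, ?_⟩
  · intro k hk
    obtain ⟨i, hi, j, hj1, hj2, rfl⟩ := (hmem k).1 hk
    rw [Finset.mem_range]
    have := (h1 i i.2).2.2
    have h3 : (j + 1) * d ≤ L * d := Nat.mul_le_mul_right _ (by omega)
    have := i.2
    have := add_mul j 1 d
    omega
  · set i0 := I.min' hI with hi0
    have hi0I : i0 ∈ I := Finset.min'_mem _ _
    obtain ⟨-, q2, -⟩ := h1 i0 i0.2
    refine ⟨a i0 * d + i0, (hmem _).2 ⟨i0, hi0I, a i0, le_rfl, q2, rfl⟩, ?_⟩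
    intro k hk
    obtain ⟨i, hi, j, hj1, hj2, rfl⟩ := (hmem k).1 hk
    have hle : i0 ≤ i := Finset.min'_le _ _ hi
    rcases hle.lt_or_eq with hlt | heq
    · have hlt' : (i0 : ℕ) < i := hlt
      obtain ⟨r1, r2⟩ := h2 i0 i hlt' i.2
      have h3 : a i0 * d ≤ j * d := Nat.mul_le_mul_right _ (by omega)
      refine ⟨by omega, fun _ => ⟨j * d + i0, (hmem _).2 ⟨i0, hi0I, j, by omega, by omega, rfl⟩,
        by omega, ?_⟩⟩
      have := i.2
      omega
    · rw [← heq] at hj1 hj2 ⊢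
      have h3 : a i0 * d ≤ j * d := Nat.mul_le_mul_right _ (by omega)
      refine ⟨by omega, fun hne => ?_⟩
      have hj : a i0 < j := by
        rcases hj1.lt_or_eq with h | h
        · exact h
        · exact absurd (by rw [h]) hne
      have h4 : (j - 1) * d + d = j * d := by
        rw [← Nat.succ_mul]; congr 1; omega
      exact ⟨(j - 1) * d + i0, (hmem _).2 ⟨i0, hi0I, j - 1, by omega, by omega, rfl⟩,
        by omega, by omega⟩
  · rw [Finset.sum_image (fun _ _ _ _ h => hF h), Finset.sum_sigma]

theorem forward_dir {X : Type} [MetricSpace X] [CompactSpace X] (T : X ≃ₜ X)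
    (hmin : MinimalTDS T) (d : ℕ) (hd : 1 ≤ d) (x y : X) (h : RPd T d x y)
    (U : Set X) (hU : IsOpen U) (hy : y ∈ U) : PoincareRecSet d (Nset T x U) := by
  intro Y _ _ ν _ S hS A hA hpos
  have hc : 0 < ν.real A := ENNReal.toReal_pos hpos.ne' (measure_ne_top _ _)
  obtain ⟨L, hL⟩ := ph_lemma ν S hS d (ν.real A) hc
  obtain ⟨P, hP⟩ := top_main T hmin d x y h U hU hy (L * d)
  obtain ⟨a, b, h1, h2, h3⟩ := hL A hA le_rfl (fun i j => P (j * d + i)) 0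
  refine ⟨fun i => ∑ j ∈ Finset.Ico (a i) (b i), P (j * d + i), ?_, ?_⟩
  · rintro _ ⟨I, hI, rfl⟩
    obtain ⟨Sf, hs1, hs2, hs3⟩ := gap_set d hd a b L h1 h2 P I hI
    change hIter T _ x ∈ U
    rw [hs3]
    exact hP Sf hs1 hs2
  · have h4 := (ENNReal.toReal_pos_iff.1 h3).1
    refine lt_of_lt_of_le h4 (measure_mono ?_)
    intro ω hω
    have key : ∀ I : Finset (Fin d), zIter S.toEquiv
        (∑ i ∈ I, ∑ j ∈ Finset.Ico (a i) (b i), P (j * d + i)) ω ∈ A := by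
      intro I
      have := hω (fun k => if hk : k < d then decide ((⟨k, hk⟩ : Fin d) ∈ I) else false)
      rw [Finset.sum_range] at this
      convert this using 2
      simp [Finset.sum_ite_mem]
    refine ⟨?_, ?_⟩
    · have := key ∅
      simpa [zIter_zero] using this
    · rw [Set.mem_iInter₂]
      rintro _ ⟨I, hI, rfl⟩
      exact key I
end MeasPart

section BackPart

theorem exists_invariant {X : Type} [MetricSpace X] [CompactSpace X] [MeasurableSpace X]
    [BorelSpace X] (T : X ≃ₜ X) (x : X) :
    ∃ μ : Measure X, IsProbabilityMeasure μ ∧ MeasurePreserving T μ μ := by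
  let m : ℕ → Measure X := fun n =>
    ((n : ENNReal) + 1)⁻¹ • ∑ k ∈ Finset.range (n + 1), Measure.dirac (T^[k] x)
  have hm : ∀ n, IsProbabilityMeasure (m n) := by
    intro n
    constructor
    simp only [m, Measure.smul_apply, Measure.coe_finset_sum, Finset.sum_apply, measure_univ]
    simp only [Finset.sum_const, Finset.card_range, nsmul_eq_mul, mul_one, smul_eq_mul]
    push_cast
    exact ENNReal.inv_mul_cancel (by simp) (by finiteness)
  let pm : ℕ → ProbabilityMeasure X := fun n => ⟨m n, hm n⟩
  let 𝒰 : Ultrafilter ℕ := hyperfilter ℕ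
  obtain ⟨μ, -, hμ⟩ := isCompact_univ.ultrafilter_le_nhds (𝒰.map pm) (by simp)
  have hμ : Tendsto pm 𝒰 (𝓝 μ) := hμ
  rw [ProbabilityMeasure.tendsto_iff_forall_integral_tendsto] at hμ
  have hint : ∀ (f : BoundedContinuousFunction X ℝ) (n : ℕ), ∫ z, f z ∂(m n) =
      ((n : ℝ) + 1)⁻¹ * ∑ k ∈ Finset.range (n + 1), f (T^[k] x) := by
    intro f n
    simp only [m]
    rw [integral_smul_measure, integral_finset_sum_measure]
    · simp only [integral_dirac, smul_eq_mul, ENNReal.toReal_inv]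
      congr 2
    · intro i _
      exact f.integrable _
  refine ⟨(μ : Measure X), inferInstance, T.measurable, ?_⟩
  haveI : IsProbabilityMeasure (Measure.map T (μ : Measure X)) :=
    Measure.isProbabilityMeasure_map T.measurable.aemeasurable
  apply ext_of_forall_integral_eq_of_IsFiniteMeasure
  intro f
  rw [integral_map T.measurable.aemeasurable f.continuous.aestronglyMeasurable]
  let g : BoundedContinuousFunction X ℝ := f.compContinuous ⟨T, T.continuous⟩
  have h1 := hμ f
  have h2 := hμ g
  have h3 := h2.sub h1
  have h4 : Tendsto (fun n : ℕ => (2 * ‖f‖) * (1 / ((n : ℝ) + 1))) 𝒰 (𝓝 ((2 * ‖f‖) * 0)) :=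
    (tendsto_one_div_add_atTop_nhds_zero_nat.mono_left
      (Nat.hyperfilter_le_atTop)).const_mul _
  rw [mul_zero] at h4
  have h5 : Tendsto (fun n => ∫ z, g z ∂(pm n : Measure X) - ∫ z, f z ∂(pm n : Measure X)) 𝒰
      (𝓝 0) := by
    apply squeeze_zero_norm _ h4
    intro n
    change ‖∫ z, g z ∂(m n) - ∫ z, f z ∂(m n)‖ ≤ _
    rw [hint, hint, ← mul_sub, ← Finset.sum_sub_distrib]
    have : ∀ k, g (T^[k] x) - f (T^[k] x) = f (T^[k + 1] x) - f (T^[k] x) := by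
      intro k
      rw [Function.iterate_succ_apply']
      rfl
    simp only [this]
    rw [Finset.sum_range_sub (fun k => f (T^[k] x)), norm_mul, one_div, mul_comm]
    have hn : ‖((n : ℝ) + 1)⁻¹‖ = ((n : ℝ) + 1)⁻¹ := by
      rw [Real.norm_eq_abs, abs_of_pos]; positivity
    rw [hn]
    gcongr
    calc _ ≤ ‖f (T^[n + 1] x)‖ + ‖f (T^[0] x)‖ := norm_sub_le _ _
      _ ≤ ‖f‖ + ‖f‖ := add_le_add (f.norm_coe_le_norm _) (f.norm_coe_le_norm _)
      _ = 2 * ‖f‖ := by ring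
  have := tendsto_nhds_unique h3 h5
  exact sub_eq_zero.1 this

theorem backward_dir {X : Type} [MetricSpace X] [CompactSpace X] (T : X ≃ₜ X)
    (hmin : MinimalTDS T) (d : ℕ) (x y : X)
    (h : ∀ U : Set X, IsOpen U → y ∈ U → PoincareRecSet d (Nset T x U)) : RPd T d x y := by
  intro δ hδ
  letI : MeasurableSpace X := borel X
  haveI : BorelSpace X := ⟨rfl⟩
  obtain ⟨μ, hμ, hT⟩ := exists_invariant T x
  have hy : y ∈ Metric.ball y (δ / 2) := Metric.mem_ball_self (by positivity)
  have hpos : 0 < μ (Metric.ball y (δ / 2)) := by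
    rw [pos_iff_ne_zero]
    intro h0
    have hu : (⋃ n : ℤ, hIter T n ⁻¹' Metric.ball y (δ / 2)) = Set.univ := by
      rw [Set.eq_univ_iff_forall]
      intro z
      obtain ⟨_, ha, ⟨n, rfl⟩⟩ := (hmin z).inter_open_nonempty _ Metric.isOpen_ball ⟨y, hy⟩
      exact Set.mem_iUnion.2 ⟨n, ha⟩
    have h1 : μ (⋃ n : ℤ, hIter T n ⁻¹' Metric.ball y (δ / 2)) = 0 := by
      rw [measure_iUnion_null_iff]
      intro n
      have := (zIter_mp T.toMeasurableEquiv hT n).measure_preimage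
        (Metric.isOpen_ball (x := y) (ε := δ / 2)).measurableSet.nullMeasurableSet
      rw [h0] at this
      exact this
    rw [hu, measure_univ] at h1
    exact one_ne_zero h1
  obtain ⟨n, hn1, hn2⟩ := h _ Metric.isOpen_ball hy X μ T.toMeasurableEquiv hT _
    Metric.isOpen_ball.measurableSet hpos
  obtain ⟨z, hz1, hz2⟩ := nonempty_of_measure_ne_zero hn2.ne'
  refine ⟨x, z, n, by simpa using hδ, ?_, ?_⟩
  · rw [Metric.mem_ball, dist_comm] at hz1
    linarith
  · intro ε hε
    have hm : (∑ i ∈ ε, n i) ∈ FS n := ⟨ε, hε, rfl⟩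
    have a1 : hIter T (∑ i ∈ ε, n i) x ∈ Metric.ball y (δ / 2) := hn1 hm
    have a2 : hIter T (∑ i ∈ ε, n i) z ∈ Metric.ball y (δ / 2) := Set.mem_iInter₂.1 hz2 _ hm
    rw [Metric.mem_ball] at a1 a2
    have := dist_triangle_right (hIter T (∑ i ∈ ε, n i) x) (hIter T (∑ i ∈ ε, n i) z) y
    linarith
end BackPart

/-- `(x, y) ∈ RP^[d]` iff every `N(x, U)` is a Poincaré recurrence set of order `d`. -/
theorem statement10 {X : Type} [MetricSpace X] [CompactSpace X] (T : X ≃ₜ X)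
    (hmin : MinimalTDS T) (d : ℕ) (hd : 1 ≤ d) (x y : X) :
    RPd T d x y ↔
      ∀ U : Set X, IsOpen U → y ∈ U → PoincareRecSet d (Nset T x U) := by
  exact ⟨fun h U hU hy => forward_dir T hmin d hd x y h U hU hy,
    backward_dir T hmin d x y⟩
end

section
/- Let (X,T) be a minimal t.d.s. Then there exists a point x ∈ X such that the only y ∈ X with (x,y) ∈ RP^[∞] is y = x (i.e. (X,T) is ∞-step almost automorphic) if and only if there exists x ∈ X such that for every open neighborhood V of x, the set N(x,V) intersects every set A ⊆ ℤ that contains finite IP-sets of arbitrarily long lengths. -/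
open scoped Classical
open MeasureTheory Filter Topology

namespace S18

instance endTop (X : Type) [TopologicalSpace X] : TopologicalSpace (Function.End X) :=
  inferInstanceAs (TopologicalSpace (X → X))
instance endT2 (X : Type) [TopologicalSpace X] [T2Space X] : T2Space (Function.End X) :=
  inferInstanceAs (T2Space (X → X))
instance endCpt (X : Type) [TopologicalSpace X] [CompactSpace X] :
    CompactSpace (Function.End X) :=
  inferInstanceAs (CompactSpace (X → X))

set_option linter.unusedSectionVars false

section basics
variable {X : Type} [TopologicalSpace X]

theorem hIter_add (T : X ≃ₜ X) (m n : ℤ) (x : X) :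
    hIter T (m + n) x = hIter T m (hIter T n x) := by
  simp only [hIter, zIter, zpow_add]; rfl

theorem hIter_zero (T : X ≃ₜ X) (x : X) : hIter T 0 x = x := by
  simp [hIter, zIter]

theorem hIter_cont (T : X ≃ₜ X) (n : ℤ) : Continuous (hIter T n) := by
  induction n using Int.induction_on with
  | zero =>
    have : hIter T 0 = id := funext (hIter_zero T)
    rw [this]; exact continuous_id
  | succ i ih =>
    have : hIter T ((i : ℤ) + 1) = fun x => hIter T i (T x) := by
      funext x; rw [hIter_add]; simp [hIter, zIter]
    rw [this]; exact ih.comp T.continuous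
  | pred i ih =>
    have : hIter T (-(i : ℤ) - 1) = fun x => hIter T (-(i : ℤ)) (T.symm x) := by
      funext x; rw [sub_eq_add_neg, hIter_add]; simp [hIter, zIter]
    rw [this]; exact ih.comp T.symm.continuous

/-- iterate as an element of the monoid of self-maps -/
def itE (T : X ≃ₜ X) (n : ℤ) : Function.End X := hIter T n

theorem itE_add (T : X ≃ₜ X) (m n : ℤ) : itE T (m + n) = itE T m * itE T n :=
  funext fun x => hIter_add T m n x

theorem itE_zero (T : X ≃ₜ X) : itE T 0 = 1 := funext fun x => hIter_zero T x

theorem end_mul_apply (f g : Function.End X) (x : X) : (f * g) x = f (g x) := rfl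
theorem end_one_apply (x : X) : (1 : Function.End X) x = x := rfl

theorem eval_cont (x : X) : Continuous (fun f : Function.End X => f x) :=
  continuous_apply (A := fun _ : X => X) x

theorem end_cont_iff {Y : Type*} [TopologicalSpace Y] (F : Y → Function.End X)
    (h : ∀ x, Continuous fun y => F y x) : Continuous F :=
  continuous_pi (A := fun _ : X => X) h

theorem mulr_cont (r : Function.End X) : Continuous (· * r) :=
  end_cont_iff _ fun x => eval_cont (r x)

theorem mull_cont (T : X ≃ₜ X) (n : ℤ) : Continuous (itE T n * ·) :=
  end_cont_iff _ fun x => (hIter_cont T n).comp (eval_cont x)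

theorem closure_mul {M : Type*} [Mul M] [TopologicalSpace M] (S : Set M)
    (hr : ∀ r : M, Continuous (· * r)) (hl : ∀ s ∈ S, Continuous (s * ·))
    (hS : ∀ s ∈ S, ∀ t ∈ S, s * t ∈ S) {f g : M} (hf : f ∈ closure S) (hg : g ∈ closure S) :
    f * g ∈ closure S := by
  have h1 : ∀ s ∈ S, s * g ∈ closure S := fun s hs =>
    map_mem_closure (hl s hs) hg (fun t ht => hS s hs t ht)
  have := map_mem_closure (hr g) hf h1
  rwa [closure_closure] at this

def E1 (T : X ≃ₜ X) : Set (Function.End X) := closure (Set.range (itE T))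

def cub (T : X ≃ₜ X) {D : ℕ} (n : Fin D → ℤ) : Finset (Fin D) → Function.End X :=
  fun ε => itE T (∑ i ∈ ε, n i)

def ED (T : X ≃ₜ X) (D : ℕ) : Set (Finset (Fin D) → Function.End X) :=
  closure (Set.range (cub T))

theorem it_mem (T : X ≃ₜ X) (n : ℤ) : itE T n ∈ E1 T := subset_closure ⟨n, rfl⟩

theorem E1_mul (T : X ≃ₜ X) {f g : Function.End X} (hf : f ∈ E1 T) (hg : g ∈ E1 T) :
    f * g ∈ E1 T := by
  refine closure_mul _ mulr_cont ?_ ?_ hf hg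
  · rintro _ ⟨n, rfl⟩; exact mull_cont T n
  · rintro _ ⟨n, rfl⟩ _ ⟨m, rfl⟩; exact ⟨n + m, itE_add T n m⟩

theorem pmulr_cont {I : Type*} (r : I → Function.End X) : Continuous (· * r) :=
  continuous_pi fun i => (mulr_cont (r i)).comp (continuous_apply i)

theorem ED_mul (T : X ≃ₜ X) {D : ℕ} {f g : Finset (Fin D) → Function.End X}
    (hf : f ∈ ED T D) (hg : g ∈ ED T D) : f * g ∈ ED T D := by
  refine closure_mul _ pmulr_cont ?_ ?_ hf hg
  · rintro _ ⟨n, rfl⟩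
    exact continuous_pi fun i => (mull_cont T _).comp (continuous_apply i)
  · rintro _ ⟨n, rfl⟩ _ ⟨m, rfl⟩
    refine ⟨n + m, ?_⟩
    funext ε
    simp [cub, Finset.sum_add_distrib, itE_add]

theorem ED_empty [T2Space X] (T : X ≃ₜ X) {D : ℕ} {f : Finset (Fin D) → Function.End X}
    (hf : f ∈ ED T D) : f ∅ = 1 := by
  have hc : IsClosed {f : Finset (Fin D) → Function.End X | f ∅ = 1} :=
    isClosed_eq (continuous_apply _) continuous_const
  refine closure_minimal ?_ hc hf
  rintro _ ⟨n, rfl⟩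
  simp [cub, itE_zero]

theorem ED_coord (T : X ≃ₜ X) {D : ℕ} {f : Finset (Fin D) → Function.End X}
    (hf : f ∈ ED T D) (ε : Finset (Fin D)) : f ε ∈ E1 T :=
  map_mem_closure (f := fun f : Finset (Fin D) → Function.End X => f ε) (continuous_apply ε) hf
    (by rintro _ ⟨n, rfl⟩; exact ⟨_, rfl⟩)

theorem ED_face (T : X ≃ₜ X) {D : ℕ} (j : Fin D) {p : Function.End X} (hp : p ∈ E1 T) :
    (fun ε : Finset (Fin D) => if j ∈ ε then p else 1) ∈ ED T D := by
  refine map_mem_closure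
    (f := fun p : Function.End X => fun ε : Finset (Fin D) => if j ∈ ε then p else 1) ?_ hp ?_
  · refine continuous_pi fun ε => ?_
    by_cases h : j ∈ ε <;> simp only [h, if_true, if_false]
    · exact continuous_id
    · exact continuous_const
  · rintro _ ⟨n, rfl⟩
    refine ⟨fun i => if i = j then n else 0, ?_⟩
    funext ε
    by_cases h : j ∈ ε <;> simp [cub, h, itE_zero]

/-- pull-back along a map of cubes -/
theorem ED_pull (T : X ≃ₜ X) {D : ℕ} (φ : Finset (Fin D) → Finset (Fin D))
    (hφ : ∀ n : Fin D → ℤ, ∃ m : Fin D → ℤ, ∀ ε, ∑ i ∈ φ ε, n i = ∑ i ∈ ε, m i)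
    {f : Finset (Fin D) → Function.End X} (hf : f ∈ ED T D) : (fun ε => f (φ ε)) ∈ ED T D := by
  refine map_mem_closure (f := fun f : Finset (Fin D) → Function.End X => fun ε => f (φ ε))
    (continuous_pi fun ε => continuous_apply _) hf ?_
  rintro _ ⟨n, rfl⟩
  obtain ⟨m, hm⟩ := hφ n
  exact ⟨m, by funext ε; simp [cub, hm]⟩

theorem ED_erase (T : X ≃ₜ X) {D : ℕ} (j : Fin D)
    {f : Finset (Fin D) → Function.End X} (hf : f ∈ ED T D) :
    (fun ε => f (ε.erase j)) ∈ ED T D := by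
  refine ED_pull T (fun ε => ε.erase j) (fun n => ⟨fun i => if i = j then 0 else n i, fun ε => ?_⟩) hf
  rw [← Finset.filter_ne', Finset.sum_filter]
  refine Finset.sum_congr rfl fun i _ => ?_
  by_cases h : i = j <;> simp [h]

/-- the element with `1` at the empty set and `v` elsewhere -/
def prm {D : ℕ} (v : Function.End X) : Finset (Fin D) → Function.End X :=
  fun ε => if ε = ∅ then 1 else v

theorem prm_mem (T : X ≃ₜ X) {D : ℕ} {v : Function.End X} (hv : v ∈ E1 T) (hvv : v * v = v) :
    (prm v : Finset (Fin D) → Function.End X) ∈ ED T D := by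
  have key : ∀ J : Finset (Fin D),
      (fun ε : Finset (Fin D) => if (ε ∩ J) = ∅ then (1 : Function.End X) else v) ∈ ED T D := by
    intro J
    induction J using Finset.induction_on with
    | empty =>
      refine subset_closure ⟨0, ?_⟩
      funext ε; simp [cub, itE_zero]
    | insert j J hj ih =>
      have := ED_mul T (ED_face T j hv) ih
      convert this using 1
      funext ε
      by_cases h : j ∈ ε
      · by_cases h2 : ε ∩ J = ∅ <;>
        simp [h, h2, hvv, Finset.inter_insert_of_mem]
      · by_cases h2 : ε ∩ J = ∅ <;>
        simp [h, h2, Finset.inter_insert_of_notMem]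
  have := key Finset.univ
  simp only [Finset.inter_univ] at this
  exact this

theorem ED_orbit [T2Space X] [CompactSpace X] (T : X ≃ₜ X) {D : ℕ} (x : X)
    (w : Finset (Fin D) → X) :
    w ∈ closure (Set.range fun n : Fin D → ℤ => fun ε => cub T n ε x) ↔
      ∃ h ∈ ED T D, ∀ ε, h ε x = w ε := by
  have hc : Continuous (fun h : Finset (Fin D) → Function.End X => fun ε => h ε x) :=
    continuous_pi fun ε => (eval_cont x).comp (continuous_apply ε)
  constructor
  · intro hw
    have hcl : IsClosed ((fun h : Finset (Fin D) → Function.End X => fun ε => h ε x) '' ED T D) :=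
      (isClosed_closure.isCompact.image hc).isClosed
    have := closure_minimal (s := Set.range fun n : Fin D → ℤ => fun ε => cub T n ε x) (by
      rintro _ ⟨n, rfl⟩
      exact ⟨cub T n, subset_closure ⟨n, rfl⟩, rfl⟩) hcl hw
    obtain ⟨h, hh, e⟩ := this
    exact ⟨h, hh, fun ε => congrFun e ε⟩
  · rintro ⟨h, hh, e⟩
    have : w = fun ε => h ε x := funext fun ε => (e ε).symm
    rw [this]
    exact map_mem_closure hc hh (by rintro _ ⟨n, rfl⟩; exact ⟨n, rfl⟩)

theorem E1_orbit [T2Space X] [CompactSpace X] (T : X ≃ₜ X) (hmin : MinimalTDS T) (x z : X) :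
    ∃ s ∈ E1 T, s x = z := by
  have hcl : IsClosed ((fun h : Function.End X => h x) '' E1 T) :=
      (isClosed_closure.isCompact.image (eval_cont x)).isClosed
  exact closure_minimal (s := Set.range fun n : ℤ => hIter T n x) (by
      rintro _ ⟨n, rfl⟩
      exact ⟨itE T n, it_mem T n, rfl⟩) hcl (hmin x z)

end basics

section ideal
variable {X : Type} [TopologicalSpace X] [T2Space X] [CompactSpace X]

/-- minimal closed left ideals of the enveloping semigroup -/
structure MinL (T : X ≃ₜ X) (L : Set (Function.End X)) : Prop where
  sub : L ⊆ E1 T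
  ne : L.Nonempty
  cl : IsClosed L
  mul : ∀ s ∈ E1 T, ∀ l ∈ L, s * l ∈ L
  tr : ∀ l ∈ L, ∀ l' ∈ L, ∃ k ∈ L, k * l = l'

theorem exists_MinL (T : X ≃ₜ X) : ∃ L, MinL T L := by
  let S : Set (Set (Function.End X)) :=
    {L | L ⊆ E1 T ∧ L.Nonempty ∧ IsClosed L ∧ ∀ s ∈ E1 T, ∀ l ∈ L, s * l ∈ L}
  obtain ⟨L, hL⟩ : ∃ L, Minimal (· ∈ S) L := by
    refine zorn_superset _ fun c hcs hc => ?_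
    rcases c.eq_empty_or_nonempty with rfl | hne
    · exact ⟨E1 T, ⟨subset_rfl, ⟨_, it_mem T 0⟩, isClosed_closure, fun s hs l hl => E1_mul T hs hl⟩,
        by simp⟩
    · refine ⟨⋂₀ c, ⟨?_, ?_, ?_, ?_⟩, fun s hs => Set.sInter_subset_of_mem hs⟩
      · obtain ⟨a, ha⟩ := hne
        exact (Set.sInter_subset_of_mem ha).trans (hcs ha).1
      · haveI : Nonempty c := hne.to_subtype
        rw [Set.sInter_eq_iInter]
        refine IsCompact.nonempty_iInter_of_directed_nonempty_isCompact_isClosed _ ?_ ?_ ?_ ?_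
        · exact DirectedOn.directed_val (IsChain.directedOn hc.symm)
        · exact fun i => (hcs i.2).2.1
        · exact fun i => (hcs i.2).2.2.1.isCompact
        · exact fun i => (hcs i.2).2.2.1
      · exact isClosed_sInter fun s hs => (hcs hs).2.2.1
      · intro s hs l hl a ha
        exact (hcs ha).2.2.2 s hs l (hl a ha)
  obtain ⟨h1, h2, h3, h4⟩ := hL.prop
  refine ⟨L, h1, h2, h3, h4, fun l hl l' hl' => ?_⟩
  have hS : ((fun k => k * l) '' L) ∈ S := by
    refine ⟨?_, h2.image _, (h3.isCompact.image (mulr_cont l)).isClosed, ?_⟩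
    · rintro _ ⟨k, hk, rfl⟩
      exact E1_mul T (h1 hk) (h1 hl)
    · rintro s hs _ ⟨k, hk, rfl⟩
      exact ⟨s * k, h4 s hs k hk, mul_assoc _ _ _⟩
  have hsub : ((fun k => k * l) '' L) ⊆ L := by
    rintro _ ⟨k, hk, rfl⟩
    exact h4 k (h1 hk) l hl
  have := hL.le_of_le hS hsub hl'
  exact this

variable {T : X ≃ₜ X} {L : Set (Function.End X)}

theorem MinL.rid (hL : MinL T L) {v w : Function.End X} (hv : v ∈ L) (hw : w ∈ L)
    (hww : w * w = w) : v * w = v := by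
  obtain ⟨k, -, hk⟩ := hL.tr w hw v hv
  rw [← hk, mul_assoc, hww]

theorem MinL.reach (hL : MinL T L) (hmin : MinimalTDS T) (x z : X) : ∃ l ∈ L, l x = z := by
  obtain ⟨l, hl⟩ := hL.ne
  obtain ⟨s, hs, e⟩ := E1_orbit T hmin (l x) z
  exact ⟨s * l, hL.mul s hs l hl, e⟩

theorem MinL.idem (hL : MinL T L) (hmin : MinimalTDS T) (y : X) :
    ∃ u ∈ L, u * u = u ∧ u y = y := by
  obtain ⟨l, hl, e⟩ := hL.reach hmin y y
  obtain ⟨u, hu, h⟩ := exists_idempotent_in_compact_subsemigroup mulr_cont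
    (L ∩ {f | f y = y}) ⟨l, hl, e⟩
    ((hL.cl.inter (isClosed_eq (eval_cont y) continuous_const)).isCompact) (by
      rintro f ⟨hf, hf'⟩ g ⟨hg, hg'⟩
      refine ⟨hL.mul f (hL.sub hf) g hg, ?_⟩
      simp only [Set.mem_setOf_eq] at *
      rw [end_mul_apply, hg', hf'])
  exact ⟨u, hu.1, h, hu.2⟩

variable {D : ℕ}

theorem prm_idem {v : Function.End X} (hvv : v * v = v) :
    (prm v : Finset (Fin D) → Function.End X) * prm v = prm v := by
  funext ε; by_cases h : ε = ∅ <;> simp [prm, h, hvv]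

/-- left inverses -/
theorem left_inv (hL : MinL T L) {v : Function.End X} (hv : v ∈ L) (hvv : v * v = v)
    {h : Finset (Fin D) → Function.End X} (hh : h ∈ ED T D) :
    ∃ k ∈ ED T D, prm v * k * h * prm v = prm v := by
  have hp := prm_mem T (D := D) (hL.sub hv) hvv
  have hhp := ED_mul T hh hp
  obtain ⟨w, ⟨k, hk, rfl⟩, hw⟩ := exists_idempotent_in_compact_subsemigroup
    (M := Finset (Fin D) → Function.End X) pmulr_cont
    ((fun k => k * (h * prm v)) '' ED T D) ⟨_, _, hp, rfl⟩
    (isClosed_closure.isCompact.image (pmulr_cont _)) (by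
      rintro _ ⟨k, hk, rfl⟩ _ ⟨k', hk', rfl⟩
      exact ⟨k * (h * prm v) * k', ED_mul T (ED_mul T hk hhp) hk', by simp only [mul_assoc]⟩)
  refine ⟨k, hk, ?_⟩
  funext ε
  have e := congrFun hw ε
  by_cases hε : ε = ∅
  · subst hε
    simp [prm, ED_empty T hk, ED_empty T hh]
  · simp only [Pi.mul_apply, prm, hε, if_false] at e ⊢
    have hmem : k ε * (h ε * v) ∈ L :=
      hL.mul _ (ED_coord T hk ε) _ (hL.mul _ (ED_coord T hh ε) _ hv)
    have := hL.rid hv hmem e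
    simpa only [mul_assoc] using this

/-- the group of elements of `ED` with identity `prm v` -/
def Gam (T : X ≃ₜ X) (D : ℕ) (v : Function.End X) : Set (Finset (Fin D) → Function.End X) :=
  {g | g ∈ ED T D ∧ prm v * g = g ∧ g * prm v = g}

theorem Gam_mul {v : Function.End X} {f g : Finset (Fin D) → Function.End X}
    (hf : f ∈ Gam T D v) (hg : g ∈ Gam T D v) : f * g ∈ Gam T D v :=
  ⟨ED_mul T hf.1 hg.1, by rw [← mul_assoc, hf.2.1], by rw [mul_assoc, hg.2.2]⟩

theorem Gam_of (hL : MinL T L) {v : Function.End X} (hv : v ∈ L) (hvv : v * v = v)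
    {h : Finset (Fin D) → Function.End X} (hh : h ∈ ED T D) :
    prm v * h * prm v ∈ Gam T D v := by
  have hp := prm_mem T (D := D) (hL.sub hv) hvv
  have hi := prm_idem (D := D) hvv
  refine ⟨ED_mul T (ED_mul T hp hh) hp, ?_, ?_⟩
  · rw [← mul_assoc, ← mul_assoc, hi]
  · rw [mul_assoc, hi]

theorem Gam_linv (hL : MinL T L) {v : Function.End X} (hv : v ∈ L) (hvv : v * v = v)
    {g : Finset (Fin D) → Function.End X} (hg : g ∈ Gam T D v) :
    ∃ k ∈ Gam T D v, k * g = prm v := by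
  obtain ⟨k, hk, e⟩ := left_inv hL hv hvv hg.1
  refine ⟨prm v * k * prm v, Gam_of hL hv hvv hk, ?_⟩
  rw [mul_assoc _ _ g, hg.2.1]
  rw [mul_assoc _ g, hg.2.2] at e
  exact e

theorem Gam_inv (hL : MinL T L) {v : Function.End X} (hv : v ∈ L) (hvv : v * v = v)
    {g : Finset (Fin D) → Function.End X} (hg : g ∈ Gam T D v) :
    ∃ k ∈ Gam T D v, k * g = prm v ∧ g * k = prm v := by
  obtain ⟨k, hk, e⟩ := Gam_linv hL hv hvv hg
  obtain ⟨k', hk', e'⟩ := Gam_linv hL hv hvv hk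
  refine ⟨k, hk, e, ?_⟩
  have : k' = g := by
    rw [← hk'.2.2, ← e, ← mul_assoc, e', hg.2.1]
  rw [← this, e']

/-- normalisation: an element moving only the top vertex -/
theorem normalise (hL : MinL T L) {v : Function.End X} (hv : v ∈ L) (hvv : v * v = v)
    {x y : X} (hvx : v x = x) (hvy : v y = y) {h : Finset (Fin D) → Function.End X}
    (hh : h ∈ ED T D) (hx : ∀ ε, ε ≠ Finset.univ → h ε x = x) (hy : h Finset.univ x = y)
    (hD : (Finset.univ : Finset (Fin D)) ≠ ∅) :
    ∃ g ∈ Gam T D v, (∀ η, η ≠ ∅ → η ≠ Finset.univ → g η = v) ∧ g Finset.univ x = y := by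
  have pv : ∀ η : Finset (Fin D), (prm v : Finset (Fin D) → Function.End X) η x = x := by
    intro η; by_cases h : η = ∅ <;> simp [prm, h, hvx, end_one_apply]
  have key : ∀ J : Finset (Fin D), ∃ g ∈ Gam T D v, (∀ ε, ε ≠ Finset.univ → g ε x = x) ∧
      g Finset.univ x = y ∧ ∀ η, η ≠ ∅ → (∃ j ∈ J, j ∉ η) → g η = v := by
    intro J
    induction J using Finset.induction_on with
    | empty =>
      refine ⟨prm v * h * prm v, Gam_of hL hv hvv hh, ?_, ?_, by simp⟩
      · intro ε hε
        simp only [Pi.mul_apply, end_mul_apply, pv, hx ε hε]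
      · simp only [Pi.mul_apply, end_mul_apply, pv, hy]
        simp [prm, hD, hvy]
    | insert j J hj ih =>
      obtain ⟨g, hg, g1, g2, g3⟩ := ih
      have hf := Gam_of hL hv hvv (ED_erase T j hg.1)
      obtain ⟨k, hk, k1, k2⟩ := Gam_inv hL hv hvv hf
      have kx : ∀ η, k η x = x := by
        intro η
        have := congrFun (congrFun k1 η) x
        simp only [Pi.mul_apply, end_mul_apply, pv] at this
        rw [g1 _ (by intro h; have := Finset.mem_univ j; rw [← h] at this; simp at this), pv] at this
        exact this
      refine ⟨g * k, Gam_mul hg hk, ?_, ?_, ?_⟩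
      · intro ε hε; simp only [Pi.mul_apply, end_mul_apply, kx, g1 ε hε]
      · simp only [Pi.mul_apply, end_mul_apply, kx, g2]
      · rintro η hη ⟨i, hi, hiη⟩
        have gl : v * g η = g η := by
          have := congrFun hg.2.1 η; simpa [prm, hη] using this
        have gr : g η * v = g η := by
          have := congrFun hg.2.2 η; simpa [prm, hη] using this
        have kl : v * k η = k η := by
          have := congrFun hk.2.1 η; simpa [prm, hη] using this
        have k2' : v * g (η.erase j) * v * k η = v := by
          have := congrFun k2 η; simpa [prm, hη] using this
        simp only [Pi.mul_apply]
        by_cases hjη : j ∈ η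
        · have hiJ : i ∈ J := by
            rcases Finset.mem_insert.1 hi with rfl | h
            · exact absurd hjη hiη
            · exact h
          rw [g3 η hη ⟨i, hiJ, hiη⟩]
          have : v * g (η.erase j) * v = v := by
            by_cases he : η.erase j = ∅
            · rw [he, ED_empty T hg.1, mul_one, hvv]
            · rw [g3 _ he ⟨i, hiJ, fun h => hiη (Finset.mem_of_mem_erase h)⟩, hvv, hvv]
          rwa [this] at k2'
        · rw [Finset.erase_eq_of_notMem hjη, gl, gr] at k2'
          exact k2'
  obtain ⟨g, hg, -, g2, g3⟩ := key Finset.univ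
  refine ⟨g, hg, fun η h1 h2 => g3 η h1 ?_, g2⟩
  by_contra hcon
  push Not at hcon
  exact h2 (Finset.eq_univ_iff_forall.2 fun j => hcon j (Finset.mem_univ j))

/-- from the top vertex to all vertices -/
theorem spread (hL : MinL T L) {u γ : Function.End X} (hu : u ∈ L) (huu : u * u = u)
    (hγ1 : u * γ = γ) (hγ2 : γ * u = γ) {e : Finset (Fin D) → Function.End X}
    (he : e ∈ ED T D) (h1 : ∀ η, η ≠ ∅ → η ≠ Finset.univ → e η = u) (h2 : e Finset.univ = γ)
    (hD : (Finset.univ : Finset (Fin D)) ≠ ∅) :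
    ∃ g ∈ ED T D, ∀ η, η ≠ ∅ → g η = γ := by
  let Pat : Set (Finset (Fin D)) → Prop := fun A =>
    ∃ g ∈ Gam T D u, ∀ η, η ≠ ∅ → g η = if η ∈ A then γ else u
  have hrem : ∀ A : Set (Finset (Fin D)), ∀ η, η ≠ ∅ → Pat A → Pat {η} → Pat (A \ {η}) := by
    rintro A η hη ⟨g, hg, hgA⟩ ⟨s, hs, hsA⟩
    by_cases hηA : η ∈ A
    · obtain ⟨k, hk, k1, k2⟩ := Gam_inv hL hu huu hs
      refine ⟨g * k, Gam_mul hg hk, fun η' hη' => ?_⟩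
      have kl : u * k η' = k η' := by
        have := congrFun hk.2.1 η'; simpa [prm, hη'] using this
      have k2' : s η' * k η' = u := by
        have := congrFun k2 η'; simpa [prm, hη'] using this
      rw [hsA η' hη'] at k2'
      rw [Pi.mul_apply, hgA η' hη']
      by_cases hc : η' = η
      · subst hc
        simp only [Set.mem_singleton_iff, if_true] at k2'
        simp [hηA, k2']
      · simp only [Set.mem_singleton_iff, hc, if_false, kl] at k2'
        rw [k2']
        by_cases hA : η' ∈ A <;> simp [hA, hc, hγ2, huu]
    · rw [Set.diff_singleton_eq_self hηA]; exact ⟨g, hg, hgA⟩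
  have hadd : ∀ A : Set (Finset (Fin D)), ∀ η, η ≠ ∅ → η ∉ A → Pat A → Pat {η} →
      Pat (insert η A) := by
    rintro A η hη hηA ⟨g, hg, hgA⟩ ⟨s, hs, hsA⟩
    refine ⟨g * s, Gam_mul hg hs, fun η' hη' => ?_⟩
    rw [Pi.mul_apply, hgA η' hη', hsA η' hη']
    by_cases hc : η' = η
    · subst hc; simp [hηA, hγ1]
    · by_cases hA : η' ∈ A <;> simp [hA, hc, hγ2, huu]
  have hup : ∀ ε : Finset (Fin D), ε ≠ ∅ → Pat {η | ε ⊆ η} := by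
    intro ε hε
    obtain ⟨i0, hi0⟩ := Finset.nonempty_iff_ne_empty.2 hε
    let φ : Finset (Fin D) → Finset (Fin D) := fun η => (η ∩ ε) ∪ (if i0 ∈ η then εᶜ else ∅)
    have hφ : (fun η => e (φ η)) ∈ ED T D := by
      refine ED_pull T φ (fun n => ⟨fun i => (if i ∈ ε then n i else 0) +
        if i = i0 then ∑ j ∈ εᶜ, n j else 0, fun η => ?_⟩) he
      rw [Finset.sum_add_distrib, Finset.sum_ite_mem, Finset.sum_ite_eq', Finset.sum_union]
      · by_cases h : i0 ∈ η <;> simp [h]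
      · by_cases h : i0 ∈ η
        · simp only [h, if_true]
          exact Finset.disjoint_of_subset_left Finset.inter_subset_right disjoint_compl_right
        · simp [h]
    refine ⟨_, Gam_of hL hu huu hφ, fun η hη => ?_⟩
    simp only [Pi.mul_apply, prm, hη, if_false, Set.mem_setOf_eq]
    by_cases hs : ε ⊆ η
    · have : φ η = Finset.univ := by
        simp only [φ, hs hi0, if_true, Finset.inter_eq_right.2 hs, Finset.union_compl]
      rw [this, h2, if_pos hs, hγ1, hγ2]
    · rw [if_neg hs]
      by_cases hz : φ η = ∅
      · rw [hz, ED_empty T he, mul_one, huu]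
      · rw [h1 _ hz, huu, huu]
        intro hcon
        apply hs
        intro i hi
        have : i ∈ φ η := by rw [hcon]; exact Finset.mem_univ i
        simp only [φ, Finset.mem_union, Finset.mem_inter] at this
        rcases this with h | h
        · exact h.1
        · split_ifs at h
          · exact absurd hi (Finset.mem_compl.1 h)
          · simp at h
  have hsing : ∀ ε : Finset (Fin D), ε ≠ ∅ → Pat {ε} := by
    intro ε
    refine WellFoundedGT.induction (motive := fun ε => ε ≠ ∅ → Pat {ε}) ε ?_
    · intro ε ih hε
      have aux : ∀ B : Finset (Finset (Fin D)), (∀ η ∈ B, ε ⊂ η) → Pat ({η | ε ⊆ η} \ (B : Set _)) := by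
        intro B
        induction B using Finset.induction_on with
        | empty => intro _; simpa using hup ε hε
        | insert η B hη ihB =>
          intro hB
          have hηε := hB η (Finset.mem_insert_self _ _)
          have hne : η ≠ ∅ := fun h => by subst h; exact Finset.not_ssubset_empty _ hηε
          have := hrem _ η hne (ihB fun η' h' => hB η' (Finset.mem_insert_of_mem h'))
            (ih η hηε hne)
          rw [Set.diff_diff] at this
          rw [Finset.coe_insert, Set.insert_eq, Set.union_comm]
          exact this
      have := aux (Finset.univ.filter fun η => ε ⊂ η) (by simp)
      convert this using 1
      ext η
      simp only [Set.mem_singleton_iff, Set.mem_diff, Set.mem_setOf_eq, Finset.coe_filter,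
        Finset.mem_univ, true_and]
      constructor
      · rintro rfl; exact ⟨subset_rfl, fun h => h.ne rfl⟩
      · rintro ⟨a, b⟩
        by_contra hc
        exact b (Finset.ssubset_iff_subset_ne.2 ⟨a, fun h => hc h.symm⟩)
  have hall : ∀ B : Finset (Finset (Fin D)), (∀ η ∈ B, η ≠ ∅) → Pat (B : Set _) := by
    intro B
    induction B using Finset.induction_on with
    | empty =>
      intro _
      have hi := prm_idem (D := D) huu
      refine ⟨prm u, ⟨prm_mem T (hL.sub hu) huu, hi, hi⟩, fun η hη => ?_⟩
      simp [prm, hη]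
    | insert η B hη ihB =>
      intro hB
      rw [Finset.coe_insert]
      exact hadd _ η (hB η (Finset.mem_insert_self _ _)) (by simpa using hη)
        (ihB fun η' h' => hB η' (Finset.mem_insert_of_mem h'))
        (hsing η (hB η (Finset.mem_insert_self _ _)))
  obtain ⟨g, hg, hgA⟩ := hall (Finset.univ.filter fun η => η ≠ ∅) (by simp)
  refine ⟨g, hg.1, fun η hη => ?_⟩
  rw [hgA η hη]; simp [hη]

end ideal

section suff
variable {X : Type} [MetricSpace X] [CompactSpace X]

/-- the FIP-star recurrence property -/
def FStar (T : X ≃ₜ X) (x : X) : Prop := ∀ V : Set X, IsOpen V → x ∈ V →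
        ∀ A : Set ℤ, ContainsArbLongFIP A → (Nset T x V ∩ A).Nonempty

theorem lemE {T : X ≃ₜ X} {x z : X} (hx : FStar T x)
    (hz : ∀ D : ℕ, 1 ≤ D → ∃ h ∈ ED T D, ∀ ε, ε ≠ ∅ → h ε x = z) : z = x := by
  by_contra hne
  obtain ⟨U, V, hU, hV, hzU, hxV, hd⟩ := t2_separation hne
  obtain ⟨m, hm1, hm2⟩ := hx V hV hxV (Nset T x U) (by
    intro D hD
    obtain ⟨h, hh, e⟩ := hz D hD
    have hw := (ED_orbit T x (fun ε => h ε x)).2 ⟨h, hh, fun _ => rfl⟩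
    have ho : IsOpen {w : Finset (Fin D) → X | ∀ ε, ε ≠ ∅ → w ε ∈ U} := by
      have : {w : Finset (Fin D) → X | ∀ ε, ε ≠ ∅ → w ε ∈ U} =
          ⋂ ε : Finset (Fin D), {w | ε ≠ ∅ → w ε ∈ U} := by
        ext w; simp
      rw [this]
      refine isOpen_iInter_of_finite fun ε => ?_
      by_cases hε : ε = ∅
      · simp [hε]
      · simp only [ne_eq, hε, not_false_eq_true, forall_true_left]
        exact hU.preimage (continuous_apply ε)
    obtain ⟨_, hw1, n, rfl⟩ := mem_closure_iff.1 hw _ ho (by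
      intro ε hε
      show h ε x ∈ U
      rw [e ε hε]; exact hzU)
    refine ⟨n, ?_⟩
    rintro _ ⟨I, hI, rfl⟩
    exact hw1 I hI.ne_empty)
  exact Set.disjoint_left.1 hd hm2 hm1

theorem idem_fix {T : X ≃ₜ X} {x : X} (hx : FStar T x) {u : Function.End X} (hu : u ∈ E1 T)
    (huu : u * u = u) : u x = x :=
  lemE hx fun D _ => ⟨prm u, prm_mem T hu huu, fun ε hε => by simp [prm, hε]⟩

/-- the space of cubes -/
def Qs (T : X ≃ₜ X) (D : ℕ) : Set (Finset (Fin D) → X) :=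
  closure {w | ∃ (n : Fin D → ℤ) (z : X), w = fun ε => cub T n ε z}

theorem generic [Nonempty X] (T : X ≃ₜ X) (D : ℕ) : ∃ x0 : X, ∀ w ∈ Qs T D, w ∅ = x0 →
    w ∈ closure (Set.range fun n : Fin D → ℤ => fun ε => cub T n ε x0) := by
  let B := TopologicalSpace.countableBasis (Finset (Fin D) → X)
  let W : Set (Finset (Fin D) → X) → Set X := fun O => {z | ∃ n : Fin D → ℤ, (fun ε => cub T n ε z) ∈ O}
  have hWo : ∀ O, IsOpen O → IsOpen (W O) := by
    intro O hO
    have : W O = ⋃ n : Fin D → ℤ, (fun z => (fun ε => cub T n ε z)) ⁻¹' O := by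
      ext z; simp [W]
    rw [this]
    refine isOpen_iUnion fun n => hO.preimage ?_
    exact continuous_pi fun ε => hIter_cont T _
  have hd : Dense (⋂ O ∈ B, (frontier (W O))ᶜ) := by
    refine dense_biInter_of_isOpen (fun O _ => isClosed_frontier.isOpen_compl)
      (TopologicalSpace.countable_countableBasis _) fun O hO => ?_
    have := interior_frontier (isClosed_compl_iff.2 (hWo O (TopologicalSpace.isOpen_of_mem_countableBasis hO)))
    rw [frontier_compl] at this
    exact interior_eq_empty_iff_dense_compl.1 this
  obtain ⟨x0, hx0⟩ := hd.nonempty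
  refine ⟨x0, fun w hw hw0 => ?_⟩
  rw [(TopologicalSpace.isBasis_countableBasis _).mem_closure_iff]
  intro O hO hwO
  have hOo := TopologicalSpace.isOpen_of_mem_countableBasis hO
  have hcl : x0 ∈ closure (W O) := by
    rw [mem_closure_iff]
    intro N hN hx0N
    obtain ⟨_, ⟨hcO, hcN⟩, n, z, rfl⟩ := mem_closure_iff.1 hw (O ∩ (fun w : Finset (Fin D) → X => w ∅) ⁻¹' N)
      (hOo.inter (hN.preimage (continuous_apply (A := fun _ => X) ∅))) ⟨hwO, by simpa [hw0] using hx0N⟩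
    refine ⟨z, ?_, n, hcO⟩
    simpa [cub, itE_zero, end_one_apply] using hcN
  have hnf := Set.mem_iInter₂.1 hx0 O hO
  rw [(hWo O hOo).frontier_eq] at hnf
  have : x0 ∈ W O := by
    by_contra hc
    exact hnf ⟨hcl, hc⟩
  obtain ⟨n, hn⟩ := this
  exact ⟨_, hn, n, rfl⟩

theorem Qs_it {T : X ≃ₜ X} {D : ℕ} {w : Finset (Fin D) → X} (hw : w ∈ Qs T D) (a : ℤ) :
    (fun ε => itE T a (w ε)) ∈ Qs T D := by
  refine map_mem_closure (f := fun w : Finset (Fin D) → X => fun ε => itE T a (w ε))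
    (continuous_pi fun ε => (hIter_cont T a).comp (continuous_apply ε)) hw ?_
  rintro _ ⟨n, z, rfl⟩
  refine ⟨n, itE T a z, ?_⟩
  funext ε
  simp only [cub, ← end_mul_apply, ← itE_add, add_comm]

theorem Qs_E1 {T : X ≃ₜ X} {D : ℕ} {w : Finset (Fin D) → X} (hw : w ∈ Qs T D)
    {p : Function.End X} (hp : p ∈ E1 T) : (fun ε => p (w ε)) ∈ Qs T D := by
  have := map_mem_closure (f := fun p : Function.End X => fun ε => p (w ε)) (t := Qs T D)
    (continuous_pi fun ε => eval_cont (w ε)) hp (by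
      rintro _ ⟨a, rfl⟩; exact Qs_it hw a)
  rwa [Qs, closure_closure] at this

theorem Qs_orbit {T : X ≃ₜ X} {D : ℕ} {h : Finset (Fin D) → Function.End X} (hh : h ∈ ED T D)
    (x : X) : (fun ε => h ε x) ∈ Qs T D := by
  refine closure_mono ?_ ((ED_orbit T x (fun ε => h ε x)).2 ⟨h, hh, fun _ => rfl⟩)
  rintro _ ⟨n, rfl⟩
  exact ⟨n, x, rfl⟩

theorem Qs_refl {T : X ≃ₜ X} {D : ℕ} {w : Finset (Fin D) → X} (hw : w ∈ Qs T D)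
    (R : Finset (Fin D)) : (fun ε => w (symmDiff ε R)) ∈ Qs T D := by
  refine map_mem_closure (f := fun w : Finset (Fin D) → X => fun ε => w (symmDiff ε R))
    (continuous_pi fun ε => continuous_apply _) hw ?_
  rintro _ ⟨n, z, rfl⟩
  refine ⟨fun i => if i ∈ R then - n i else n i, itE T (∑ i ∈ R, n i) z, ?_⟩
  funext ε
  simp only [cub, ← end_mul_apply, ← itE_add]
  congr 2
  have e1 : ∑ i ∈ symmDiff ε R, n i = ∑ i, if i ∈ symmDiff ε R then n i else 0 := by simp
  have e2 : ∑ i ∈ R, n i = ∑ i, if i ∈ R then n i else 0 := by simp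
  have e3 : (∑ i ∈ ε, if i ∈ R then - n i else n i) =
    ∑ i, if i ∈ ε then (if i ∈ R then - n i else n i) else 0 := by simp
  rw [e1, e2, e3, ← Finset.sum_add_distrib]
  refine Finset.sum_congr rfl fun i _ => ?_
  by_cases h1 : i ∈ ε <;> by_cases h2 : i ∈ R <;> simp [Finset.mem_symmDiff, h1, h2]

/-- cubes from regional proximality -/
theorem Qs_pair {T : X ≃ₜ X} (hmin : MinimalTDS T) {D : ℕ} (l : Fin D) (n : Fin D → ℤ) (x y : X) :
    (fun ε => hIter T (∑ i ∈ ε.erase l, n i) (if l ∈ ε then y else x)) ∈ Qs T D := by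
  have hy : y ∈ closure (Set.range fun m : ℤ => hIter T m x) := hmin x y
  refine map_mem_closure (f := fun y : X => fun ε : Finset (Fin D) =>
    hIter T (∑ i ∈ ε.erase l, n i) (if l ∈ ε then y else x)) ?_ hy ?_
  · refine continuous_pi fun ε => (hIter_cont T _).comp ?_
    by_cases h : l ∈ ε <;> simp only [h, if_true, if_false]
    · exact continuous_id
    · exact continuous_const
  · rintro _ ⟨m, rfl⟩
    refine ⟨Function.update n l m, x, ?_⟩
    funext ε
    show _ = hIter T _ x
    by_cases h : l ∈ ε
    · simp only [h, if_true]
      rw [← hIter_add, ← Finset.sum_erase_add _ _ h]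
      congr 2
      · refine Finset.sum_congr rfl fun i hi => ?_
        rw [Function.update_of_ne (Finset.ne_of_mem_erase hi)]
      · simp
    · simp only [h, if_false]
      rw [Finset.erase_eq_of_notMem h]
      congr 1
      refine Finset.sum_congr rfl fun i hi => ?_
      rw [Function.update_of_ne]; rintro rfl; exact h hi

theorem Qs_RP {T : X ≃ₜ X} (hmin : MinimalTDS T) {D : ℕ} (l : Fin D) {x y : X}
    (h : RPd T D x y) : ∃ w ∈ Qs T D, w ∅ = x ∧ w {l} = y ∧
      ∀ ε : Finset (Fin D), ε.erase l ≠ ∅ → w ε = w (ε.erase l) := by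
  let K : ℕ → Set (Finset (Fin D) → X) := fun k => Qs T D ∩ {w | dist x (w ∅) ≤ 1 / ((k : ℝ) + 1) ∧
    dist y (w {l}) ≤ 1 / ((k : ℝ) + 1) ∧
    ∀ ε : Finset (Fin D), ε.erase l ≠ ∅ → dist (w (ε.erase l)) (w ε) ≤ 1 / ((k : ℝ) + 1)}
  have hcl : ∀ k, IsClosed (K k) := by
    intro k
    refine isClosed_closure.inter ?_
    have c1 : IsClosed {w : Finset (Fin D) → X | dist x (w ∅) ≤ 1 / ((k : ℝ) + 1)} :=
      isClosed_le (by fun_prop) continuous_const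
    have c2 : IsClosed {w : Finset (Fin D) → X | dist y (w {l}) ≤ 1 / ((k : ℝ) + 1)} :=
      isClosed_le (by fun_prop) continuous_const
    refine c1.inter (c2.inter ?_)
    have : {w : Finset (Fin D) → X | ∀ ε : Finset (Fin D), ε.erase l ≠ ∅ → dist (w (ε.erase l)) (w ε) ≤ 1 / ((k : ℝ) + 1)}
      = ⋂ ε : Finset (Fin D), ⋂ _ : ε.erase l ≠ ∅, {w | dist (w (ε.erase l)) (w ε) ≤ 1 / ((k : ℝ) + 1)} := by
      ext w; simp only [Set.mem_iInter]; rfl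
    have c3 : IsClosed {w : Finset (Fin D) → X | ∀ ε : Finset (Fin D), ε.erase l ≠ ∅ →
        dist (w (ε.erase l)) (w ε) ≤ 1 / ((k : ℝ) + 1)} := by
      rw [this]
      exact isClosed_iInter fun ε => isClosed_iInter fun _ =>
        isClosed_le (by fun_prop) continuous_const
    exact c3
  have hne : (⋂ k, K k).Nonempty := by
    refine IsCompact.nonempty_iInter_of_sequence_nonempty_isCompact_isClosed K ?_ ?_
      (hcl 0).isCompact hcl
    · rintro k w ⟨hw, h1, h2, h3⟩
      have hle : 1 / (((k + 1 : ℕ) : ℝ) + 1) ≤ 1 / ((k : ℝ) + 1) := by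
        apply one_div_le_one_div_of_le (by positivity)
        push_cast; linarith
      exact ⟨hw, h1.trans hle, h2.trans hle, fun ε hε => (h3 ε hε).trans hle⟩
    · intro k
      obtain ⟨x', y', n, h1, h2, h3⟩ := h (1 / ((k : ℝ) + 1)) (by positivity)
      refine ⟨_, Qs_pair hmin l n x' y', ?_, ?_, ?_⟩
      · simpa [hIter_zero] using h1.le
      · simpa [hIter_zero] using h2.le
      · intro ε hε
        by_cases hl : l ∈ ε
        · simpa [hl] using (h3 _ (Finset.nonempty_iff_ne_empty.2 hε)).le
        · rw [Finset.erase_eq_of_notMem hl, dist_self]; positivity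
  obtain ⟨w, hw⟩ := hne
  have hw' := fun k => Set.mem_iInter.1 hw k
  have lim : ∀ a b : X, (∀ k : ℕ, dist a b ≤ 1 / ((k : ℝ) + 1)) → a = b := fun a b hab =>
    dist_le_zero.1 (ge_of_tendsto' tendsto_one_div_add_atTop_nhds_zero_nat hab)
  exact ⟨w, (hw' 0).1, (lim _ _ fun k => (hw' k).2.1).symm, (lim _ _ fun k => (hw' k).2.2.1).symm,
    fun ε hε => (lim _ _ fun k => (hw' k).2.2.2 ε hε).symm⟩

end suff

section back
variable {X : Type} [MetricSpace X] [CompactSpace X]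

theorem back {T : X ≃ₜ X} (hmin : MinimalTDS T) {x y : X} (hx : FStar T x)
    (hy : ∀ d : ℕ, 1 ≤ d → RPd T d x y) : y = x := by
  refine lemE hx fun D hD => ?_
  haveI : Nonempty X := ⟨x⟩
  let l : Fin D := ⟨0, hD⟩
  have hD' : (Finset.univ : Finset (Fin D)) ≠ ∅ := (Finset.nonempty_iff_ne_empty.1 ⟨l, Finset.mem_univ l⟩)
  obtain ⟨w, hwQ, hw0, hwl, hwe⟩ := Qs_RP hmin l (hy D hD)
  obtain ⟨x0, hx0⟩ := generic T D
  obtain ⟨L, hL⟩ := exists_MinL T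
  obtain ⟨u, hu, huu, huy⟩ := hL.idem hmin y
  have hux : u x = x := idem_fix hx (hL.sub hu) huu
  obtain ⟨p, hp, hpx⟩ := hL.reach hmin x x0
  obtain ⟨q, hq, hqp⟩ := hL.tr p hp u hu
  have hpu : p * u = p := hL.rid hp hu huu
  obtain ⟨y0, hpy⟩ : ∃ y0, p y = y0 := ⟨_, rfl⟩
  have hqx : q x0 = x := by rw [← hpx, ← end_mul_apply q p, hqp, hux]
  have hqy : q y0 = y := by rw [← hpy, ← end_mul_apply q p, hqp, huy]
  obtain ⟨v, hvd⟩ : ∃ v, v = p * q := ⟨_, rfl⟩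
  have hv : v ∈ L := hvd ▸ hL.mul _ (hL.sub hp) _ hq
  have hvv : v * v = v := by
    rw [hvd, mul_assoc, ← mul_assoc q, hqp, ← mul_assoc, hpu]
  have hvx : v x0 = x0 := by rw [hvd, end_mul_apply, hqx, hpx]
  have hvy : v y0 = y0 := by rw [hvd, end_mul_apply, hqy, hpy]
  have pv : ∀ η : Finset (Fin D), (prm v : Finset (Fin D) → Function.End X) η x0 = x0 := by
    intro η; by_cases h : η = ∅ <;> simp [prm, h, hvx, end_one_apply]
  -- step 4
  obtain ⟨h, hh, hhw⟩ := (ED_orbit T x0 _).1 (hx0 _ (Qs_E1 hwQ (hL.sub hp)) (by rw [hw0, hpx]))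
  obtain ⟨k, hk, hke⟩ := left_inv hL hv hvv (ED_erase T l hh)
  have hk' := ED_mul T (prm_mem T (D := D) (hL.sub hv) hvv) hk
  obtain ⟨k', hk'd⟩ : ∃ k' : Finset (Fin D) → Function.End X, k' = prm v * k := ⟨_, rfl⟩
  rw [← hk'd] at hk' hke
  have hkx : ∀ η : Finset (Fin D), k' η (h (η.erase l) x0) = x0 := by
    intro η
    have := congrFun (congrFun hke η) x0
    rw [pv, Pi.mul_apply, end_mul_apply, pv, Pi.mul_apply, end_mul_apply] at this
    exact this
  have hc1 := ED_mul T (ED_erase T l hk') hh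
  have hc1e : (fun ε => ((fun ε : Finset (Fin D) => k' (ε.erase l)) * h) ε x0) =
      fun ε => if ε = {l} then y0 else x0 := by
    funext ε
    rw [Pi.mul_apply, end_mul_apply]
    by_cases he : ε.erase l = ∅
    · rw [he, ED_empty T hk', end_one_apply, hhw]
      rcases (Finset.erase_eq_empty_iff _ _).1 he with rfl | rfl
      · rw [if_neg (Finset.singleton_ne_empty l).symm, hw0, hpx]
      · rw [if_pos rfl, hwl, hpy]
    · rw [if_neg (by rintro rfl; simp at he), hhw, hwe ε he, ← hhw]
      have := hkx (ε.erase l)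
      rwa [Finset.erase_idem] at this
  have hc1Q := Qs_orbit hc1 x0
  rw [hc1e] at hc1Q
  -- step 5
  have hc0Q := Qs_refl hc1Q ({l}ᶜ)
  have hiff : ∀ ε : Finset (Fin D), symmDiff ε {l}ᶜ = {l} ↔ ε = Finset.univ := by
    intro ε
    constructor
    · intro he
      have := symmDiff_symmDiff_cancel_right ({l}ᶜ : Finset (Fin D)) ε
      rw [he, symmDiff_compl_self] at this
      exact this.symm
    · rintro rfl
      have : symmDiff (⊤ : Finset (Fin D)) {l}ᶜ = {l} := by
        ext i; simp [Finset.mem_symmDiff]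
      exact this
  simp only [hiff] at hc0Q
  obtain ⟨h', hh', hhw'⟩ := (ED_orbit T x0 _).1 (hx0 _ hc0Q (by rw [if_neg hD'.symm]))
  obtain ⟨g, hg, hgv, hgy⟩ := normalise hL hv hvv hvx hvy hh'
    (fun ε hε => by rw [hhw', if_neg hε]) (by rw [hhw', if_pos rfl]) hD'
  -- step 6
  have hpum := prm_mem T (D := D) (hL.sub hu) huu
  have he := ED_mul T (ED_mul T (ED_mul T (ED_mul T hpum (ED_face T l (hL.sub hq))) hg.1)
    (ED_face T l (hL.sub hp))) hpum
  obtain ⟨G, hG, hGe⟩ := spread hL hu huu (γ := u * q * g Finset.univ * p * u)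
    (by simp only [← mul_assoc, huu]) (by simp only [mul_assoc, huu]) he (by
      intro η h1 h2
      simp only [Pi.mul_apply, prm, h1, if_false, hgv η h1 h2]
      by_cases hl : l ∈ η
      · simp only [hl, if_true]
        rw [hvd, show u * q * (p * q) * p * u = u * (q * p) * (q * p) * u by simp only [mul_assoc],
          hqp, huu, huu, huu]
      · simp only [hl, if_false, mul_one]
        rw [hL.rid hu hv hvv, huu]) (by
      simp only [Pi.mul_apply, prm, hD', if_false, Finset.mem_univ, if_true]) hD'
  refine ⟨G, hG, fun ε hε => ?_⟩
  rw [hGe ε hε]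
  simp only [end_mul_apply, hux, hpx, hgy, hqy, huy]

end back

section forw

/-- finite sets under disjoint union, with an absorbing element -/
inductive DU : Type
  | bot : DU
  | mk (F : Finset ℕ) : DU

def DU.mul : DU → DU → DU
  | DU.bot, _ => DU.bot
  | DU.mk _, DU.bot => DU.bot
  | DU.mk F, DU.mk G => if Disjoint F G then DU.mk (F ∪ G) else DU.bot

theorem DU.mul_bot (a : DU) : DU.mul a DU.bot = DU.bot := by cases a <;> rfl
theorem DU.bot_mul (a : DU) : DU.mul DU.bot a = DU.bot := by cases a <;> rfl
theorem DU.mul_mk (F G : Finset ℕ) : DU.mul (DU.mk F) (DU.mk G) =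
    if Disjoint F G then DU.mk (F ∪ G) else DU.bot := rfl

theorem DU.assoc (a b c : DU) : DU.mul (DU.mul a b) c = DU.mul a (DU.mul b c) := by
  rcases a with _ | F <;> rcases b with _ | G <;> rcases c with _ | H <;>
    try simp only [DU.mul_bot, DU.bot_mul]
  rw [DU.mul_mk F G, DU.mul_mk G H]
  by_cases h1 : Disjoint F G <;> by_cases h2 : Disjoint G H <;>
    by_cases h3 : Disjoint F H <;>
    simp [h1, h2, h3, DU.mul_mk, DU.mul_bot, DU.bot_mul, Finset.disjoint_union_left,
      Finset.disjoint_union_right, Finset.union_assoc]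

instance : CommMonoid DU where
  mul := DU.mul
  one := DU.mk ∅
  mul_assoc := DU.assoc
  one_mul := by
    rintro (_ | F)
    · rfl
    · show DU.mul (DU.mk ∅) (DU.mk F) = DU.mk F
      simp [DU.mul_mk]
  mul_one := by
    rintro (_ | F)
    · rfl
    · show DU.mul (DU.mk F) (DU.mk ∅) = DU.mk F
      simp [DU.mul_mk]
  mul_comm := by
    rintro (_ | F) (_ | G) <;> try rfl
    show DU.mul (DU.mk F) (DU.mk G) = DU.mul (DU.mk G) (DU.mk F)
    simp [DU.mul_mk, disjoint_comm, Finset.union_comm]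

theorem DU.mk_mul {F G : Finset ℕ} (h : Disjoint F G) : DU.mk F * DU.mk G = DU.mk (F ∪ G) := by
  show DU.mul (DU.mk F) (DU.mk G) = DU.mk (F ∪ G)
  simp [DU.mul_mk, h]

theorem DU.mk_mul_eq {F G H : Finset ℕ} (h : DU.mk F * DU.mk G = DU.mk H) : Disjoint F G := by
  by_contra hc
  have h' : DU.mul (DU.mk F) (DU.mk G) = DU.mk H := h
  simp [DU.mul_mk, hc] at h'

theorem DU.mk_inj {F G : Finset ℕ} (h : DU.mk F = DU.mk G) : F = G := DU.mk.inj h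

theorem FP_std (a : Stream' DU) (m : DU) (hm : m ∈ Hindman.FP a) : ∀ j : ℕ,
    (a = fun k => DU.mk {k + j}) → ∃ F : Finset ℕ, m = DU.mk F ∧ F.Nonempty ∧ ∀ i ∈ F, j ≤ i := by
  induction hm with
  | head' a =>
    rintro j rfl
    refine ⟨{j}, ?_, by simp, by simp⟩
    show DU.mk {0 + j} = _
    rw [zero_add]
  | tail' a m h ih =>
    rintro j rfl
    obtain ⟨F, h1, h2, h3⟩ := ih (j + 1) (by
      funext k
      show DU.mk {k + 1 + j} = _
      rw [add_right_comm, add_assoc])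
    exact ⟨F, h1, h2, fun i hi => (Nat.le_succ j).trans (h3 i hi)⟩
  | cons' a m h ih =>
    rintro j rfl
    obtain ⟨F, h1, h2, h3⟩ := ih (j + 1) (by
      funext k
      show DU.mk {k + 1 + j} = _
      rw [add_right_comm, add_assoc])
    refine ⟨{j} ∪ F, ?_, by simp, ?_⟩
    · show DU.mk {0 + j} * m = _
      rw [zero_add, h1, DU.mk_mul]
      rw [Finset.disjoint_singleton_left]
      intro hj
      have := h3 j hj
      omega
    · intro i hi
      rcases Finset.mem_union.1 hi with h | h
      · simp at h; omega
      · have := h3 i h; omega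

theorem hind {X : Type} [MetricSpace X] [CompactSpace X] (φ : Finset ℕ → X) {δ : ℝ} (hδ : 0 < δ) :
    ∃ β : ℕ → Finset ℕ, (∀ i, (β i).Nonempty) ∧ (∀ i j, i ≠ j → Disjoint (β i) (β j)) ∧
      ∀ s t : Finset ℕ, s.Nonempty → t.Nonempty →
        dist (φ (s.biUnion β)) (φ (t.biUnion β)) < δ := by
  obtain ⟨t, -, htf, hcov⟩ := finite_cover_balls_of_compact (isCompact_univ (X := X)) (half_pos hδ)
  let C : X → Set DU := fun c => {m | ∃ F : Finset ℕ, m = DU.mk F ∧ F.Nonempty ∧ dist (φ F) c < δ / 2}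
  obtain ⟨_, ⟨c, hc, rfl⟩, b, hb⟩ := Hindman.FP_partition_regular
    (fun k => DU.mk {k + 0} : Stream' DU) (C '' t) (htf.image C) (by
      intro m hm
      obtain ⟨F, h1, h2, -⟩ := FP_std _ m hm 0 rfl
      obtain ⟨c, hc, hd⟩ := Set.mem_iUnion₂.1 (hcov (Set.mem_univ (φ F)))
      exact ⟨C c, ⟨c, hc, rfl⟩, F, h1, h2, hd⟩)
  have hprod : ∀ s : Finset ℕ, s.Nonempty → ∃ F : Finset ℕ, ∏ i ∈ s, b.get i = DU.mk F ∧
      F.Nonempty ∧ dist (φ F) c < δ / 2 := fun s hs => hb (Hindman.FP.finsetProd b s hs)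
  have h1 : ∀ i, ∃ F : Finset ℕ, b.get i = DU.mk F ∧ F.Nonempty := fun i => by
    obtain ⟨F, h, h', -⟩ := hprod {i} (by simp)
    exact ⟨F, by simpa using h, h'⟩
  choose β hβ hβn using h1
  have hdis : ∀ i j, i ≠ j → Disjoint (β i) (β j) := by
    intro i j hij
    obtain ⟨F, h, -⟩ := hprod {i, j} (by simp)
    rw [Finset.prod_pair hij, hβ, hβ] at h
    exact DU.mk_mul_eq h
  have hun : ∀ s : Finset ℕ, ∏ i ∈ s, b.get i = DU.mk (s.biUnion β) := by
    intro s
    induction s using Finset.induction_on with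
    | empty => rfl
    | insert i s hi ih =>
      rw [Finset.prod_insert hi, ih, hβ, DU.mk_mul, Finset.biUnion_insert]
      rw [Finset.disjoint_biUnion_right]
      intro j hj
      exact hdis i j (by rintro rfl; exact hi hj)
  have hd : ∀ s : Finset ℕ, s.Nonempty → dist (φ (s.biUnion β)) c < δ / 2 := by
    intro s hs
    obtain ⟨F, h, -, h'⟩ := hprod s hs
    rw [hun] at h
    rwa [DU.mk_inj h]
  refine ⟨β, hβn, hdis, fun s t hs ht => ?_⟩
  have := dist_triangle_right (φ (s.biUnion β)) (φ (t.biUnion β)) c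
  linarith [hd s hs, hd t ht]

variable {X : Type} [MetricSpace X] [CompactSpace X]

theorem approx {T : X ≃ₜ X} {x : X} {V : Set X} {A : Set ℤ} (hA : ContainsArbLongFIP A)
    (hVA : ∀ m ∈ A, hIter T m x ∉ V) (d : ℕ) {δ : ℝ} (hδ : 0 < δ) :
    ∃ y' ∉ V, ∃ n : Fin d → ℤ, ∀ ε : Finset (Fin d), ε.Nonempty →
      dist (hIter T (∑ i ∈ ε, n i) x) (hIter T (∑ i ∈ ε, n i) y') < δ := by
  choose p hp using fun k : ℕ => hA (k + 1) (Nat.le_add_left 1 k)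
  let P : ℕ → ℕ → ℤ := fun k i => if h : i < k + 1 then p k ⟨i, h⟩ else 0
  have hP : ∀ k, ∀ F : Finset ℕ, F.Nonempty → F ⊆ Finset.range (k + 1) → ∑ i ∈ F, P k i ∈ A := by
    intro k F hF hFk
    refine hp k ⟨Finset.univ.filter fun i : Fin (k + 1) => (i : ℕ) ∈ F, ?_, ?_⟩
    · obtain ⟨i, hi⟩ := hF
      exact ⟨⟨i, Finset.mem_range.1 (hFk hi)⟩, by simpa using hi⟩
    · symm
      refine Finset.sum_bij (fun (i : Fin (k + 1)) _ => (i : ℕ)) ?_ ?_ ?_ ?_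
      · intro i hi; simpa using hi
      · intro i _ j _ h; exact Fin.ext h
      · intro i hi
        exact ⟨⟨i, Finset.mem_range.1 (hFk hi)⟩, by simpa using hi, rfl⟩
      · intro i _
        have hi := i.2
        simp only [P]
        rw [dif_pos hi]
  have hlim : ∀ F : Finset ℕ, ∃ z : X,
      Tendsto (fun k => hIter T (∑ i ∈ F, P k i) x) (hyperfilter ℕ : Filter ℕ) (𝓝 z) := by
    intro F
    obtain ⟨z, -, hz⟩ := isCompact_univ.ultrafilter_le_nhds
      ((hyperfilter ℕ).map fun k => hIter T (∑ i ∈ F, P k i) x) (by simp)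
    exact ⟨z, hz⟩
  choose φ hφ using hlim
  obtain ⟨β, hβn, hβd, hβ⟩ := hind φ (δ := δ / 3) (by linarith)
  have ev1 : ∀ᶠ k in (hyperfilter ℕ : Filter ℕ), ∀ s ∈ (Finset.range (d + 1)).powerset,
      dist (hIter T (∑ i ∈ s.biUnion β, P k i) x) (φ (s.biUnion β)) < δ / 3 := by
    rw [Filter.eventually_all_finset]
    intro s _
    exact (hφ _).eventually (Metric.ball_mem_nhds _ (by linarith))
  have ev2 : ∀ᶠ k in (hyperfilter ℕ : Filter ℕ), β d ⊆ Finset.range (k + 1) := by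
    have : ∀ᶠ k in atTop, β d ⊆ Finset.range (k + 1) := by
      filter_upwards [eventually_ge_atTop ((β d).sup id)] with k hk i hi
      have : i ≤ (β d).sup id := Finset.le_sup (f := id) hi
      rw [Finset.mem_range]; omega
    rw [← Nat.cofinite_eq_atTop] at this
    exact hyperfilter_le_cofinite this
  obtain ⟨k, hk1, hk2⟩ := (ev1.and ev2).exists
  refine ⟨hIter T (∑ i ∈ β d, P k i) x, hVA _ (hP k _ (hβn d) hk2),
    fun i => ∑ j ∈ β i, P k j, fun ε hε => ?_⟩
  have hs1 : ∀ s : Finset ℕ, ∑ i ∈ s.biUnion β, P k i = ∑ i ∈ s, ∑ j ∈ β i, P k j := fun s =>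
    Finset.sum_biUnion fun i _ j _ hij => hβd i j hij
  obtain ⟨s, hs⟩ : ∃ s : Finset ℕ, s = ε.map Fin.valEmbedding := ⟨_, rfl⟩
  have hsn : s.Nonempty := by rw [hs]; exact hε.map
  have hss : s ⊆ Finset.range d := by
    rw [hs]; intro i hi
    obtain ⟨j, -, rfl⟩ := Finset.mem_map.1 hi
    exact Finset.mem_range.2 j.2
  have hds : d ∉ s := fun h => by have := hss h; simp at this
  have e1 : ∑ i ∈ ε, ∑ j ∈ β (i : ℕ), P k j = ∑ i ∈ s.biUnion β, P k i := by
    rw [hs1, hs, Finset.sum_map]; rfl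
  have e2 : (∑ i ∈ ε, ∑ j ∈ β (i : ℕ), P k j) + ∑ i ∈ β d, P k i =
      ∑ i ∈ (insert d s).biUnion β, P k i := by
    rw [e1, hs1, hs1, Finset.sum_insert hds, add_comm]
  rw [← hIter_add, e2, e1]
  have hr : Finset.range d ⊆ Finset.range (d + 1) := Finset.range_mono (Nat.le_succ d)
  have a1 := hk1 s (Finset.mem_powerset.2 (hss.trans hr))
  have a2 := hk1 (insert d s) (Finset.mem_powerset.2 (Finset.insert_subset (by simp) (hss.trans hr)))
  have a3 := hβ s (insert d s) hsn (by simp)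
  have t1 := dist_triangle4_right (hIter T (∑ i ∈ s.biUnion β, P k i) x)
    (hIter T (∑ i ∈ (insert d s).biUnion β, P k i) x) (φ (s.biUnion β)) (φ ((insert d s).biUnion β))
  linarith

theorem forw {T : X ≃ₜ X} {x : X} (hx : ∀ y : X, (∀ d : ℕ, 1 ≤ d → RPd T d x y) → y = x) :
    FStar T x := by
  intro V hV hxV A hA
  by_contra hc
  have hVA : ∀ m ∈ A, hIter T m x ∉ V := fun m hm h => hc ⟨m, h, hm⟩
  choose y hyV n hn using fun j : ℕ => approx hA hVA (j + 1) (δ := 1 / ((j : ℝ) + 1)) (by positivity)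
  obtain ⟨z, hz, ψ, hψ, hlim⟩ := (hV.isClosed_compl.isCompact).tendsto_subseq hyV
  have : z = x := by
    refine hx z fun d hd δ hδ => ?_
    have ev1 : ∀ᶠ j in atTop, dist (y (ψ j)) z < δ := hlim.eventually (Metric.ball_mem_nhds _ hδ)
    have ev2 : ∀ᶠ j in atTop, 1 / ((ψ j : ℝ) + 1) < δ :=
      (tendsto_one_div_add_atTop_nhds_zero_nat.comp hψ.tendsto_atTop).eventually (gt_mem_nhds hδ)
    have ev3 : ∀ᶠ j in atTop, d ≤ ψ j := hψ.tendsto_atTop.eventually (eventually_ge_atTop d)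
    obtain ⟨j, h1, h2, h3⟩ := (ev1.and (ev2.and ev3)).exists
    have hle : d ≤ ψ j + 1 := by omega
    refine ⟨x, y (ψ j), fun i => n (ψ j) (Fin.castLE hle i), by simpa using hδ,
      by rwa [dist_comm], fun ε hε => ?_⟩
    have := hn (ψ j) (ε.map (Fin.castLEEmb hle)) hε.map
    rw [Finset.sum_map] at this
    exact this.trans h2
  exact hz (this ▸ hxV)

end forw

end S18

/-- A minimal t.d.s. is `∞`-step almost automorphic iff there is a point `x`
such that `N(x, V)` meets every set containing finite IP-sets of arbitrarily
long lengths, for every open neighborhood `V` of `x`. -/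
theorem statement18 {X : Type} [MetricSpace X] [CompactSpace X] (T : X ≃ₜ X)
    (hmin : MinimalTDS T) :
    (∃ x : X, ∀ y : X, (∀ d : ℕ, 1 ≤ d → RPd T d x y) → y = x) ↔
      (∃ x : X, ∀ V : Set X, IsOpen V → x ∈ V →
        ∀ A : Set ℤ, ContainsArbLongFIP A → (Nset T x V ∩ A).Nonempty) := by
  constructor
  · rintro ⟨x, hx⟩
    exact ⟨x, S18.forw hx⟩
  · rintro ⟨x, hx⟩
    exact ⟨x, fun y hy => S18.back hmin hx hy⟩
end
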